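/- arXiv:1602.07093 — 3 statements merged into one kernel-verified Lean document; each statement's English description precedes it below -/
import Mathlib

section
/- Let F be a field of characteristic 2, let φ be an anisotropic quadratic form over F of dimension 5 and type (1,3) that is not a Pfister neighbour, and let ψ be an anisotropic totally singular quadratic form over F of type (0,4) with norm degree ndeg_F(ψ) = 4. Let ψ' be any subform of ψ of dimension 3 (i.e. ψ ≅ ψ' ⊥ ⟨c⟩ for some c ∈ F). Then φ_{F(ψ)} is isotropic if and only if φ_{F(ψ')} is isotropic. -/
open QuadraticMap MvPolynomial
open scoped TensorProduct

set_option synthInstance.maxHeartbeats 1000000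
set_option maxHeartbeats 1000000


section Defs

variable {K : Type} [CommRing K]

/-- The binary quadratic form `[a,b] : (x,y) ↦ a·x² + x·y + b·y²`. -/
noncomputable def binQF (a b : K) : QuadraticForm K (Fin 2 → K) :=
  (Matrix.of ![![a, 1], ![0, b]]).toQuadraticMap'

/-- The diagonal (totally singular) quadratic form `⟨c₁, …, c_s⟩`. -/
noncomputable def diagQF {s : ℕ} (c : Fin s → K) : QuadraticForm K (Fin s → K) :=
  QuadraticMap.weightedSumSquares K c

/-- The orthogonal sum `[a₁,b₁] ⊥ ⋯ ⊥ [a_r,b_r]` of binary forms. -/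
noncomputable def binsQF {r : ℕ} (a b : Fin r → K) : QuadraticForm K (Fin r → Fin 2 → K) :=
  QuadraticMap.pi fun i => binQF (a i) (b i)

/-- The orthogonal sum of `m` hyperbolic planes `[0,0]`. -/
noncomputable def hypQF (K : Type) [CommRing K] (m : ℕ) :
    QuadraticForm K (Fin m → Fin 2 → K) :=
  binsQF (fun _ => 0) (fun _ => 0)

/-- The `(n+1)`-fold quadratic Pfister form `⟨⟨a₁,…,aₙ⟩⟩_b ⊗ [1,c]`, i.e. the orthogonal
sum over all subsets `S ⊆ {1,…,n}` of `(∏_{i∈S} aᵢ)·[1,c]`. -/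
noncomputable def pfisterQF (n : ℕ) (a : Fin n → K) (c : K) :
    QuadraticForm K (Finset (Fin n) → Fin 2 → K) :=
  QuadraticMap.pi fun S : Finset (Fin n) => (∏ i ∈ S, a i) • binQF 1 c

variable {V W : Type} [AddCommGroup V] [Module K V] [AddCommGroup W] [Module K W]

/-- `φ` has type `(r,s)`: it is isometric to `[a₁,b₁] ⊥ ⋯ ⊥ [a_r,b_r] ⊥ ⟨c₁,…,c_s⟩`. -/
def HasTypeRS (φ : QuadraticForm K V) (r s : ℕ) : Prop :=
  ∃ (a b : Fin r → K) (c : Fin s → K), φ.Equivalent ((binsQF a b).prod (diagQF c))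

/-- `φ` is dominated by `ψ`. -/
def Dominated (φ : QuadraticForm K V) (ψ : QuadraticForm K W) : Prop :=
  ∃ f : V →ₗ[K] W, Function.Injective f ∧ ∀ v, φ v = ψ (f v)

/-- `φ` is weakly dominated by `ψ`: `α·φ` is dominated by `ψ` for some unit `α`. -/
def WeaklyDominated (φ : QuadraticForm K V) (ψ : QuadraticForm K W) : Prop :=
  ∃ α : Kˣ, Dominated ((α : K) • φ) ψ

/-- Witt equivalence of quadratic forms. -/
def WittEquiv (Q₁ : QuadraticForm K V) (Q₂ : QuadraticForm K W) : Prop :=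
  ∃ k l : ℕ, (Q₁.prod (hypQF K k)).Equivalent (Q₂.prod (hypQF K l))

/-- `φ` is a Pfister neighbour: there is a quadratic Pfister form `π` with
`2·dim φ > dim π` and `φ ≺_w π`. -/
def IsPfisterNeighbour (φ : QuadraticForm K V) : Prop :=
  ∃ (n : ℕ) (a : Fin n → Kˣ) (c : K),
    2 * Module.finrank K V > 2 ^ (n + 1) ∧
      WeaklyDominated φ (pfisterQF n (fun i => (a i : K)) c)

/-- The Artin–Schreier set `℘(K) = {t² + t : t ∈ K}`. -/
def ArtinSchreier (K : Type) [CommRing K] : Set K := {x : K | ∃ t : K, x = t ^ 2 + t}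

end Defs

section FunField

variable (F : Type) [Field F]

/-- The coefficient matrix of a quadratic form on `Fin n → F` with respect to the
standard basis: diagonal entries `ψ(eᵢ)`, above-diagonal entries `b_ψ(eᵢ,eⱼ)`. -/
noncomputable def coeffMat {n : ℕ} (ψ : QuadraticForm F (Fin n → F)) :
    Matrix (Fin n) (Fin n) F :=
  Matrix.of fun i j =>
    if i = j then ψ (Pi.single i 1)
    else if i < j then polar ψ (Pi.single i 1) (Pi.single j 1) else 0

/-- The homogeneous degree 2 polynomial `P_ψ` associated to a quadratic form `ψ`. -/
noncomputable def qfPoly {n : ℕ} (ψ : QuadraticForm F (Fin n → F)) :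
    MvPolynomial (Fin n) F :=
  ∑ i : Fin n, ∑ j : Fin n, MvPolynomial.C (coeffMat F ψ i j) * (X i * X j)

/-- The affine coordinate ring `F[x₁,…,xₙ]/(P_ψ)` of the quadric `ψ = 0`. -/
def FunFieldRing {n : ℕ} (ψ : QuadraticForm F (Fin n → F)) : Type :=
  MvPolynomial (Fin n) F ⧸ Ideal.span {qfPoly F ψ}

noncomputable instance {n : ℕ} (ψ : QuadraticForm F (Fin n → F)) :
    CommRing (FunFieldRing F ψ) :=
  inferInstanceAs (CommRing (MvPolynomial (Fin n) F ⧸ Ideal.span {qfPoly F ψ}))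

noncomputable instance {n : ℕ} (ψ : QuadraticForm F (Fin n → F)) :
    Algebra F (FunFieldRing F ψ) :=
  inferInstanceAs (Algebra F (MvPolynomial (Fin n) F ⧸ Ideal.span {qfPoly F ψ}))

/-- The function field `F(ψ)` of the quadric `ψ = 0`. -/
def FunField {n : ℕ} (ψ : QuadraticForm F (Fin n → F)) : Type :=
  FractionRing (FunFieldRing F ψ)

noncomputable instance {n : ℕ} (ψ : QuadraticForm F (Fin n → F)) :
    CommRing (FunField F ψ) :=
  inferInstanceAs (CommRing (FractionRing (FunFieldRing F ψ)))

noncomputable instance {n : ℕ} (ψ : QuadraticForm F (Fin n → F)) :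
    Algebra (FunFieldRing F ψ) (FunField F ψ) :=
  inferInstanceAs (Algebra (FunFieldRing F ψ) (FractionRing (FunFieldRing F ψ)))

noncomputable instance {n : ℕ} (ψ : QuadraticForm F (Fin n → F)) :
    Algebra F (FunField F ψ) :=
  inferInstanceAs (Algebra F (FractionRing (FunFieldRing F ψ)))

/-- The canonical map `F → F(ψ)`. -/
noncomputable def funFieldMap {n : ℕ} (ψ : QuadraticForm F (Fin n → F)) :
    F →+* FunField F ψ :=
  algebraMap F (FunField F ψ)

/-- Scalar extension of a quadratic form on `Fin n → F` along a ring homomorphism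
`f : F → K`. -/
noncomputable def extendQF {K : Type} [CommRing K] (f : F →+* K) {n : ℕ}
    (φ : QuadraticForm F (Fin n → F)) : QuadraticForm K (Fin n → K) :=
  ((coeffMat F φ).map f).toQuadraticMap'

end FunField


section Quat

variable (K : Type) [CommRing K]

/-- Defining relations for the char-2 quaternion algebra `[a,b)`: generators `i,j` with
`i² + i = a`, `j² = b`, `j·i = i·j + j` (i.e. `j·i·j⁻¹ = i + 1`). -/
inductive QuatRel (a b : K) : FreeAlgebra K (Fin 2) → FreeAlgebra K (Fin 2) → Prop
  | i_sq : QuatRel a b (FreeAlgebra.ι K 0 * FreeAlgebra.ι K 0 + FreeAlgebra.ι K 0)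
      (algebraMap K _ a)
  | j_sq : QuatRel a b (FreeAlgebra.ι K 1 * FreeAlgebra.ι K 1) (algebraMap K _ b)
  | swap : QuatRel a b (FreeAlgebra.ι K 1 * FreeAlgebra.ι K 0)
      (FreeAlgebra.ι K 0 * FreeAlgebra.ι K 1 + FreeAlgebra.ι K 1)

/-- The quaternion algebra `[a,b)` over `K` (characteristic two convention). -/
def QuatAlg (a b : K) : Type := RingQuot (QuatRel K a b)

noncomputable instance (a b : K) : Ring (QuatAlg K a b) :=
  inferInstanceAs (Ring (RingQuot (QuatRel K a b)))
noncomputable instance (a b : K) : Algebra K (QuatAlg K a b) :=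
  inferInstanceAs (Algebra K (RingQuot (QuatRel K a b)))

/-- `[a,b)` is split over `K`: isomorphic to the `2×2` matrix algebra. -/
def QuatSplit (a b : K) : Prop :=
  Nonempty (QuatAlg K a b ≃ₐ[K] Matrix (Fin 2) (Fin 2) K)

end Quat

section Sqrt

variable (F : Type) [Field F]

/-- The field `F(√c₁,…,√c_s)` obtained by adjoining square roots of the `cᵢ`
(inside an algebraic closure of `F`). -/
noncomputable def sqrtExt {s : ℕ} (c : Fin s → F) :
    IntermediateField F (AlgebraicClosure F) :=
  IntermediateField.adjoin F
    {y : AlgebraicClosure F | ∃ i, y ^ 2 = algebraMap F (AlgebraicClosure F) (c i)}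

/-- The subfield `F² = {x² : x ∈ F}` of squares of a field of characteristic 2. -/
noncomputable def sqSubfield : Subfield F := Subfield.closure (Set.range fun x : F => x ^ 2)

set_option synthInstance.maxHeartbeats 1000000 in
/-- The norm degree `[F²(cᵢ·cⱼ) : F²]` of a diagonal form `⟨c₁,…,c_s⟩`. -/
noncomputable def normDegree {s : ℕ} (c : Fin s → F) : ℕ :=
  Module.finrank (sqSubfield F)
    (IntermediateField.adjoin (sqSubfield F)
      (Set.range fun p : Fin s × Fin s => c p.1 * c p.2))

end Sqrt

/-- A ring is a division algebra if it is nontrivial and every nonzero element is a unit. -/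
def IsDivisionAlgebra (T : Type) [Ring T] : Prop :=
  (0 : T) ≠ 1 ∧ ∀ x : T, x ≠ 0 → IsUnit x


namespace QuadricFunctionField

section Isotropy

variable {F : Type} [CommRing F] {n : ℕ}

/-- The quadratic form with coefficient matrix `M` is isotropic over the `F`-algebra `A`. -/
def IsotropicOver (M : Matrix (Fin n) (Fin n) F) (A : Type) [CommRing A] [Algebra F A] : Prop :=
  ∃ v : Fin n → A, v ≠ 0 ∧ ∑ i, ∑ j, algebraMap F A (M i j) * (v i * v j) = 0

variable {M : Matrix (Fin n) (Fin n) F} {A B : Type} [CommRing A] [Algebra F A]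
  [CommRing B] [Algebra F B]

theorem IsotropicOver.map (h : IsotropicOver M A) (f : A →ₐ[F] B)
    (hf : Function.Injective f) : IsotropicOver M B := by
  obtain ⟨v, hv, h0⟩ := h
  refine ⟨fun i => f (v i), fun h => hv (funext fun i => hf ?_), ?_⟩
  · simpa using congrFun h i
  · simpa [map_sum] using congrArg f h0

theorem IsotropicOver.of_polynomial (h : IsotropicOver M (Polynomial A)) :
    IsotropicOver M A := by
  obtain ⟨v, hv, h0⟩ := h
  obtain ⟨i₀, hi₀⟩ : ∃ i, v i ≠ 0 := by
    by_contra! hc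
    exact hv (funext hc)
  obtain ⟨i₁, -, hi₁⟩ := Finset.exists_max_image Finset.univ (fun i => (v i).degree)
    ⟨i₀, Finset.mem_univ _⟩
  have hne : v i₁ ≠ 0 := by
    intro h
    have := hi₁ i₀ (Finset.mem_univ _)
    rw [h, Polynomial.degree_zero, le_bot_iff, Polynomial.degree_eq_bot] at this
    exact hi₀ this
  have hle : ∀ i, (v i).natDegree ≤ (v i₁).natDegree := fun i =>
    Polynomial.natDegree_le_natDegree (hi₁ i (Finset.mem_univ _))
  refine ⟨fun i => (v i).coeff (v i₁).natDegree, fun h => hne ?_, ?_⟩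
  · simpa using congrFun h i₁
  · have := congrArg (fun p => Polynomial.coeff p ((v i₁).natDegree + (v i₁).natDegree)) h0
    simpa [Polynomial.finsetSum_coeff, Polynomial.algebraMap_apply,
      Polynomial.coeff_mul_add_eq_of_natDegree_le (hle _) (hle _)] using this

theorem IsotropicOver.of_fractionRing (h : IsotropicOver M (FractionRing A)) :
    IsotropicOver M A := by
  obtain ⟨v, hv, h0⟩ := h
  obtain ⟨b, hb⟩ := IsLocalization.exist_integer_multiples_of_finite (nonZeroDivisors A) v
  choose w hw using hb
  have hw' : ∀ i, algebraMap A (FractionRing A) (w i)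
      = algebraMap A (FractionRing A) b * v i := fun i => by
    rw [hw i, Algebra.smul_def]
  have hinj := IsFractionRing.injective A (FractionRing A)
  refine ⟨w, fun h => hv (funext fun i => ?_), hinj ?_⟩
  · have hu := IsLocalization.map_units (FractionRing A) b
    have := hw' i
    rw [h, Pi.zero_apply, map_zero] at this
    exact (hu.mul_right_eq_zero).1 this.symm
  · calc _ = algebraMap A (FractionRing A) b ^ 2 *
          ∑ i, ∑ j, algebraMap F (FractionRing A) (M i j) * (v i * v j) := by
          simp only [map_sum, map_mul, hw', Finset.mul_sum,
            ← IsScalarTower.algebraMap_apply F A (FractionRing A)]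
          refine Finset.sum_congr rfl fun i _ => Finset.sum_congr rfl fun j _ => by ring
      _ = _ := by rw [h0, mul_zero, map_zero]

theorem isotropicOver_fractionRing_iff :
    IsotropicOver M (FractionRing A) ↔ IsotropicOver M A :=
  ⟨.of_fractionRing, fun h => h.map (IsScalarTower.toAlgHom F A (FractionRing A))
    (IsFractionRing.injective A (FractionRing A))⟩

end Isotropy

section Field

variable {F : Type} [Field F] {n : ℕ}

theorem not_anisotropic_extendQF_iff (φ : QuadraticForm F (Fin n → F)) {A : Type} [CommRing A]
    [Algebra F A] :
    ¬ (extendQF F (algebraMap F A) φ).Anisotropic ↔ IsotropicOver (coeffMat F φ) A := by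
  have key : ∀ v : Fin n → A, extendQF F (algebraMap F A) φ v
      = ∑ i, ∑ j, algebraMap F A (coeffMat F φ i j) * (v i * v j) := by
    intro v
    change Matrix.toLinearMap₂' A ((coeffMat F φ).map (algebraMap F A)) v v = _
    simp only [Matrix.toLinearMap₂'_apply, Matrix.map_apply, smul_eq_mul]
    refine Finset.sum_congr rfl fun i _ => Finset.sum_congr rfl fun j _ => by ring
  simp only [QuadraticMap.Anisotropic, IsotropicOver, key, not_forall, exists_prop, ne_eq]
  exact exists_congr fun v => and_comm

/-- The polynomial `∑ cᵢ xᵢ²`. -/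
noncomputable def diagPoly (c : Fin n → F) : MvPolynomial (Fin n) F :=
  ∑ i, C (c i) * X i ^ 2

/-- The affine coordinate ring of the quadric `∑ cᵢ xᵢ² = 0`. -/
def DiagRing (c : Fin n → F) : Type :=
  MvPolynomial (Fin n) F ⧸ Ideal.span {diagPoly c}

noncomputable instance (c : Fin n → F) : CommRing (DiagRing c) :=
  inferInstanceAs (CommRing (MvPolynomial (Fin n) F ⧸ Ideal.span {diagPoly c}))

noncomputable instance (c : Fin n → F) : Algebra F (DiagRing c) :=
  inferInstanceAs (Algebra F (MvPolynomial (Fin n) F ⧸ Ideal.span {diagPoly c}))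

/-- The projection from polynomials to the coordinate ring. -/
noncomputable def DiagRing.mk (c : Fin n → F) : MvPolynomial (Fin n) F →ₐ[F] DiagRing c :=
  Ideal.Quotient.mkₐ F (Ideal.span {diagPoly c})

theorem DiagRing.mk_surjective (c : Fin n → F) : Function.Surjective (DiagRing.mk c) :=
  Ideal.Quotient.mk_surjective

theorem DiagRing.mk_eq_zero_iff {c : Fin n → F} {p : MvPolynomial (Fin n) F} :
    DiagRing.mk c p = 0 ↔ diagPoly c ∣ p :=
  Ideal.Quotient.eq_zero_iff_mem.trans Ideal.mem_span_singleton

theorem aeval_diagPoly {A : Type} [CommRing A] [Algebra F A] (c : Fin n → F) (x : Fin n → A) :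
    aeval x (diagPoly c) = ∑ i, algebraMap F A (c i) * x i ^ 2 := by
  simp [diagPoly, map_sum]

/-- A point of the quadric `∑ cᵢ xᵢ² = 0` over `A` is a homomorphism from its coordinate ring. -/
noncomputable def DiagRing.lift {A : Type} [CommRing A] [Algebra F A] (c : Fin n → F)
    (x : Fin n → A) (hx : ∑ i, algebraMap F A (c i) * x i ^ 2 = 0) : DiagRing c →ₐ[F] A :=
  Ideal.Quotient.liftₐ _ (aeval x) fun a ha => by
    obtain ⟨b, rfl⟩ := Ideal.mem_span_singleton'.1 ha
    rw [map_mul, aeval_diagPoly, hx, mul_zero]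

/-- The tautological point of the quadric over its coordinate ring. -/
noncomputable def DiagRing.x (c : Fin n → F) (i : Fin n) : DiagRing c :=
  DiagRing.mk c (X i)

@[simp]
theorem DiagRing.lift_x {A : Type} [CommRing A] [Algebra F A] (c : Fin n → F)
    (x : Fin n → A) (hx : ∑ i, algebraMap F A (c i) * x i ^ 2 = 0) (i : Fin n) :
    DiagRing.lift c x hx (DiagRing.x c i) = x i := by
  exact aeval_X x i

theorem DiagRing.hom_ext {A : Type} [CommRing A] [Algebra F A] {c : Fin n → F}
    {f g : DiagRing c →ₐ[F] A} (h : ∀ i, f (DiagRing.x c i) = g (DiagRing.x c i)) : f = g :=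
  Ideal.Quotient.algHom_ext _ (MvPolynomial.algHom_ext h)

theorem DiagRing.sum_x (c : Fin n → F) :
    ∑ i, algebraMap F (DiagRing c) (c i) * DiagRing.x c i ^ 2 = 0 := by
  have h : DiagRing.mk c (diagPoly c) = 0 := DiagRing.mk_eq_zero_iff.2 dvd_rfl
  rw [diagPoly, map_sum] at h
  refine (Finset.sum_congr rfl fun i _ => ?_).trans h
  rw [map_mul, map_pow, MvPolynomial.C_eq_algebraMap, AlgHom.commutes, DiagRing.x]

theorem DiagRing.sum_map_x {A : Type} [CommRing A] [Algebra F A] {c : Fin n → F}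
    (f : DiagRing c →ₐ[F] A) : ∑ i, algebraMap F A (c i) * f (DiagRing.x c i) ^ 2 = 0 := by
  simpa using congrArg f (DiagRing.sum_x c)

theorem diagQF_apply (c x : Fin n → F) : diagQF c x = ∑ i, c i * x i ^ 2 := by
  simp [diagQF, QuadraticMap.weightedSumSquares_apply, pow_two]

theorem isUnit_algebraMap_of_finSuccEquiv {c : Fin (n + 1) → F} (hc : c 0 ≠ 0)
    {p : MvPolynomial (Fin (n + 1)) F} {p₀ : MvPolynomial (Fin n) F} (hp₀ : p₀ ≠ 0)
    (hp : finSuccEquiv F n p = Polynomial.C p₀) :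
    IsUnit (algebraMap (DiagRing c) (FractionRing (DiagRing c)) (DiagRing.mk c p)) := by
  set P := finSuccEquiv F n (diagPoly c) with hP
  have hPeq : P = Polynomial.C (C (c 0)) * (Polynomial.X ^ 2 + Polynomial.C
      (C (c 0)⁻¹ * ∑ i : Fin n, C (c i.succ) * X i ^ 2)) := by
    have h1 : (C (c 0) * C (c 0)⁻¹ : MvPolynomial (Fin n) F) = 1 := by
      rw [← C_mul, mul_inv_cancel₀ hc, C_1]
    rw [mul_add, ← Polynomial.C_mul, ← mul_assoc, h1, one_mul, hP, diagPoly, Fin.sum_univ_succ]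
    simp [map_sum, finSuccEquiv_apply]
  have hmem : DiagRing.mk c p ∈ nonZeroDivisors (DiagRing c) := by
    rw [mem_nonZeroDivisors_iff_right]
    intro y hy
    obtain ⟨f, rfl⟩ := DiagRing.mk_surjective c y
    rw [← map_mul, DiagRing.mk_eq_zero_iff] at hy
    obtain ⟨g, hg⟩ := hy
    rw [DiagRing.mk_eq_zero_iff]
    have hg' := congrArg (finSuccEquiv F n) hg
    rw [map_mul, map_mul, hp, ← hP] at hg'
    have hdvd : Polynomial.C p₀ ∣ finSuccEquiv F n g := by
      rw [Polynomial.C_dvd_iff_dvd_coeff]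
      suffices h : (finSuccEquiv F n g).map (Ideal.Quotient.mk (Ideal.span {p₀})) = 0 by
        intro i
        rw [← Ideal.mem_span_singleton, ← Ideal.Quotient.eq_zero_iff_mem, ← Polynomial.coeff_map,
          h, Polynomial.coeff_zero]
      have h := congrArg (Polynomial.map (Ideal.Quotient.mk (Ideal.span {p₀}))) hg'
      have hz : Ideal.Quotient.mk (Ideal.span {p₀}) p₀ = 0 :=
        Ideal.Quotient.eq_zero_iff_mem.2 (Ideal.mem_span_singleton_self _)
      rw [Polynomial.map_mul, Polynomial.map_C, hz, Polynomial.C_0, mul_zero, hPeq,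
        Polynomial.map_mul, Polynomial.map_mul, Polynomial.map_C, mul_assoc] at h
      have hu : IsUnit (Polynomial.C (Ideal.Quotient.mk (Ideal.span {p₀}) (C (c 0)))) :=
        (((Ne.isUnit hc).map C).map (Ideal.Quotient.mk (Ideal.span {p₀}))).map Polynomial.C
      have h2 := hu.mul_right_eq_zero.1 h.symm
      refine (Polynomial.Monic.mul_right_eq_zero_iff ?_).1 h2
      rw [Polynomial.map_add, Polynomial.map_pow, Polynomial.map_X, Polynomial.map_C]
      exact Polynomial.monic_X_pow_add_C _ two_ne_zero
    obtain ⟨g', hg''⟩ := hdvd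
    have hCp : Polynomial.C p₀ ≠ 0 := by simpa using hp₀
    have hf : finSuccEquiv F n f = P * g' := by
      refine mul_right_cancel₀ hCp ?_
      rw [hg', hg'']; ring
    refine ⟨(finSuccEquiv F n).symm g', (finSuccEquiv F n).injective ?_⟩
    rw [map_mul, hf, AlgEquiv.apply_symm_apply]
  exact IsLocalization.map_units (M := nonZeroDivisors (DiagRing c)) _ ⟨_, hmem⟩

theorem injective_of_comp_eq_algebraMap {A B : Type} [CommRing A] [Algebra F A] [CommRing B]
    [Algebra F B] (f : A →ₐ[F] B) (g : B →ₐ[F] FractionRing A)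
    (h : g.comp f = IsScalarTower.toAlgHom F A (FractionRing A)) : Function.Injective f := by
  have : Function.Injective (g.comp f) := by
    rw [h]
    exact IsFractionRing.injective A (FractionRing A)
  exact Function.Injective.of_comp (f := g) (by simpa using this)

variable [CharP F 2]

theorem add_self_of_algebra (A : Type) [CommRing A] [Algebra F A] (a : A) : a + a = 0 := by
  have : (2 : A) = 0 := by
    have h := congrArg (algebraMap F A) (CharTwo.two_eq_zero (R := F))
    rwa [map_ofNat, map_zero] at h
  rw [← two_mul, this, zero_mul]

theorem two_of_algebra (A : Type) [CommRing A] [Algebra F A] : (2 : A) = 0 := by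
  rw [← one_add_one_eq_two, add_self_of_algebra (F := F)]

theorem sum_sq_of_algebra {ι : Type} (A : Type) [CommRing A] [Algebra F A] (s : Finset ι)
    (f : ι → A) : (∑ i ∈ s, f i) ^ 2 = ∑ i ∈ s, f i ^ 2 := by
  classical
  induction s using Finset.induction_on with
  | empty => simp
  | insert a s ha ih =>
    rw [Finset.sum_insert ha, Finset.sum_insert ha, ← ih, add_sq, mul_assoc,
      two_of_algebra (F := F) A, zero_mul, add_zero]

theorem isotropicOver_diagRing_of_equivalent {m : ℕ} {M : Matrix (Fin m) (Fin m) F}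
    {p q : Fin n → F} (h : (diagQF p).Equivalent (diagQF q))
    (hM : IsotropicOver M (DiagRing p)) : IsotropicOver M (DiagRing q) := by
  -- an isometry turns points of one quadric into points of the other
  have key : ∀ (p q : Fin n → F) (e : (diagQF p).IsometryEquiv (diagQF q)),
      ∑ i, algebraMap F (DiagRing p) (q i) * (∑ j, algebraMap F (DiagRing p)
        (e (Pi.single j 1) i) * DiagRing.x p j) ^ 2 = 0 := by
    intro p q e
    rw [← DiagRing.sum_x p]
    simp only [sum_sq_of_algebra (F := F), Finset.mul_sum]
    rw [Finset.sum_comm]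
    refine Finset.sum_congr rfl fun j _ => ?_
    have h1 : p j = ∑ i, q i * (e (Pi.single j 1) i) ^ 2 := by
      have := e.map_app (Pi.single j 1)
      rw [diagQF_apply, diagQF_apply] at this
      rw [this]
      simp [Pi.single_apply]
    conv_rhs => rw [h1]
    rw [map_sum, Finset.sum_mul]
    refine Finset.sum_congr rfl fun i _ => ?_
    rw [map_mul, map_pow]
    ring
  obtain ⟨e⟩ := h
  refine hM.map (DiagRing.lift p _ (key q p e.symm)) ?_
  refine Function.LeftInverse.injective (g := DiagRing.lift q _ (key p q e)) fun y => ?_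
  suffices h : (DiagRing.lift q _ (key p q e)).comp (DiagRing.lift p _ (key q p e.symm))
      = AlgHom.id F (DiagRing p) from congrArg (fun f => f y) h
  refine DiagRing.hom_ext fun k => ?_
  simp only [AlgHom.comp_apply, DiagRing.lift_x, map_sum, map_mul, AlgHom.commutes,
    AlgHom.id_apply, Finset.mul_sum]
  rw [Finset.sum_comm]
  have h2 : ∀ j, ∑ i, e.symm (Pi.single i 1) k * e (Pi.single j 1) i
      = (Pi.single j 1 : Fin n → F) k := by
    intro j
    have h3 : e (Pi.single j 1) = ∑ i, e (Pi.single j 1) i • (Pi.single i 1 : Fin n → F) := by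
      ext i; simp [Pi.single_apply]
    conv_rhs => rw [← e.symm_apply_apply (Pi.single j 1), h3]
    have h4 : ∀ y, e.symm y = e.toLinearEquiv.symm y := fun _ => rfl
    simp only [h4, map_sum, map_smul, Finset.sum_apply, Pi.smul_apply, smul_eq_mul, mul_comm]
  simp only [← mul_assoc, ← map_mul, ← Finset.sum_mul, ← map_sum, h2]
  simp [Pi.single_apply]

/-- A point of the quadric of `⟨a, au, b, ub⟩` yields a line of points of the neighbouring
quadric of `⟨a, au, b⟩`. -/
theorem neighbour_point {A : Type} [CommRing A] [Algebra F A] {a u b : F} {d : Fin 3 → F}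
    {q : Fin 4 → F} (hd : ![a, a * u, b] = d) (hq : ![a, a * u, b, u * b] = q) {x : Fin 4 → A}
    (t : A) (hx : ∑ i, algebraMap F A (q i) * x i ^ 2 = 0) :
    ∑ i, algebraMap F A (d i) *
      (![t * (x 0 * x 2 + algebraMap F A u * x 1 * x 3), t * (x 0 * x 3 + x 1 * x 2),
        t * (x 2 ^ 2 + algebraMap F A u * x 3 ^ 2)] i) ^ 2 = 0 := by
  simp only [← hd, ← hq, Fin.sum_univ_three, Fin.sum_univ_four, Matrix.cons_val, map_mul] at hx ⊢
  linear_combination (t ^ 2 * (x 2 ^ 2 + algebraMap F A u * x 3 ^ 2)) * hx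
    + (2 * algebraMap F A a * algebraMap F A u * t ^ 2 * x 0 * x 1 * x 2 * x 3)
      * two_of_algebra (F := F) A

/-- A point of the quadric of `⟨a, au, b⟩` yields a plane of points of the quadric of
`⟨a, au, b, ub⟩`. -/
theorem point_of_neighbour_point {A : Type} [CommRing A] [Algebra F A] {a u b : F} {d : Fin 3 → F}
    {q : Fin 4 → F} (hd : ![a, a * u, b] = d) (hq : ![a, a * u, b, u * b] = q) {x : Fin 3 → A}
    (s t : A) (hx : ∑ i, algebraMap F A (d i) * x i ^ 2 = 0) :
    ∑ i, algebraMap F A (q i) *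
      (![x 0 * s + algebraMap F A u * x 1 * t, x 0 * t + x 1 * s, x 2 * s, x 2 * t] i) ^ 2
      = 0 := by
  simp only [← hd, ← hq, Fin.sum_univ_three, Fin.sum_univ_four, Matrix.cons_val, map_mul] at hx ⊢
  linear_combination (s ^ 2 + algebraMap F A u * t ^ 2) * hx
    + (2 * algebraMap F A a * algebraMap F A u * x 0 * x 1 * s * t)
      * two_of_algebra (F := F) A

theorem isotropicOver_of_isotropicOver_neighbour {m : ℕ} {M : Matrix (Fin m) (Fin m) F}
    {a u b : F} (ha : a ≠ 0) (h : IsotropicOver M (DiagRing ![a, a * u, b])) :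
    IsotropicOver M (DiagRing ![a, a * u, b, u * b]) := by
  generalize hd : ![a, a * u, b] = d at h
  generalize hq : ![a, a * u, b, u * b] = q
  have hf := neighbour_point hd hq Polynomial.X (DiagRing.sum_map_x
    (A := Polynomial (DiagRing q)) (c := q) Polynomial.CAlgHom)
  generalize hy : (fun i => algebraMap (DiagRing d) (FractionRing (DiagRing d))
    (DiagRing.x d i)) = y
  have hy0 := DiagRing.sum_map_x (IsScalarTower.toAlgHom F (DiagRing d)
    (FractionRing (DiagRing d)))
  have hy2 : IsUnit (y 2) := by
    rw [← hy]
    exact isUnit_algebraMap_of_finSuccEquiv (p := X 2) (p₀ := X 1) (by simpa [← hd] using ha)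
      (X_ne_zero _) (finSuccEquiv_X_succ (j := (1 : Fin 2)))
  obtain ⟨z, hz⟩ := hy2.exists_right_inv
  have hg : ∑ i, algebraMap F (FractionRing (DiagRing d)) (q i) * (![y 0, y 1, y 2, 0] i) ^ 2
      = 0 := by
    refine Eq.trans ?_ hy0
    rw [← hq, ← hy, Fin.sum_univ_four, Fin.sum_univ_three]
    simp [← hd]
  refine (h.map (DiagRing.lift d _ hf) (injective_of_comp_eq_algebraMap _
    (Polynomial.aevalTower (DiagRing.lift q _ hg) z)
    (DiagRing.hom_ext fun i => ?_))).of_polynomial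
  rw [AlgHom.comp_apply, DiagRing.lift_x]
  change _ = (fun i => algebraMap (DiagRing d) (FractionRing (DiagRing d)) (DiagRing.x d i)) i
  rw [hy]
  fin_cases i <;> simp
  · linear_combination y 0 * hz
  · linear_combination y 1 * hz
  · linear_combination y 2 * hz

theorem isotropicOver_neighbour_of_isotropicOver {m : ℕ} {M : Matrix (Fin m) (Fin m) F}
    {a u b : F} (ha : a ≠ 0) (h : IsotropicOver M (DiagRing ![a, a * u, b, u * b])) :
    IsotropicOver M (DiagRing ![a, a * u, b]) := by
  generalize hd : ![a, a * u, b] = d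
  generalize hq : ![a, a * u, b, u * b] = q at h
  have hf := point_of_neighbour_point hd hq (Polynomial.C Polynomial.X) Polynomial.X
    (DiagRing.sum_map_x (A := Polynomial (Polynomial (DiagRing d))) (c := d)
      (Polynomial.CAlgHom.comp Polynomial.CAlgHom))
  generalize hy : (fun i => algebraMap (DiagRing q) (FractionRing (DiagRing q))
    (DiagRing.x q i)) = y
  generalize hV : algebraMap F (FractionRing (DiagRing q)) u = V
  have hn : IsUnit (y 2 ^ 2 + V * y 3 ^ 2) := by
    have := isUnit_algebraMap_of_finSuccEquiv (c := q) (p := X 2 ^ 2 + C u * X 3 ^ 2)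
      (p₀ := X 1 ^ 2 + C u * X 2 ^ 2) (by simpa [← hq] using ha) ?_ ?_
    · have e : y 2 ^ 2 + V * y 3 ^ 2 = algebraMap (DiagRing q) (FractionRing (DiagRing q))
          (DiagRing.mk q (X 2 ^ 2 + C u * X 3 ^ 2)) := by
        rw [← hy, ← hV, IsScalarTower.algebraMap_apply F (DiagRing q)]
        simp only [map_add, map_mul, map_pow, MvPolynomial.C_eq_algebraMap, AlgHom.commutes]
        rfl
      rw [e]
      exact this
    · intro h0
      simpa using congrArg (eval ![(0 : F), 1, 0]) h0
    · have h2 := finSuccEquiv_X_succ (R := F) (j := (1 : Fin 3))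
      have h3 := finSuccEquiv_X_succ (R := F) (j := (2 : Fin 3))
      change finSuccEquiv F 3 (X 2) = _ at h2
      change finSuccEquiv F 3 (X 3) = _ at h3
      rw [map_add, map_mul, map_pow, map_pow, h2, h3]
      simp [finSuccEquiv_apply]
  obtain ⟨z, hz⟩ := hn.exists_right_inv
  have hg := neighbour_point hd hq 1 (DiagRing.sum_map_x (IsScalarTower.toAlgHom F (DiagRing q)
    (FractionRing (DiagRing q))))
  refine (h.map (DiagRing.lift q _ hf) (injective_of_comp_eq_algebraMap _
    (Polynomial.aevalTower (Polynomial.aevalTower (DiagRing.lift d _ hg) (y 2 * z)) (y 3 * z))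
    (DiagRing.hom_ext fun i => ?_))).of_polynomial.of_polynomial
  rw [AlgHom.comp_apply, DiagRing.lift_x]
  have hyi : ∀ i, algebraMap (DiagRing q) (FractionRing (DiagRing q)) (DiagRing.x q i) = y i :=
    fun i => congrFun hy i
  have h2 := two_of_algebra (F := F) (FractionRing (DiagRing q))
  fin_cases i <;> simp [hyi, hV]
  · linear_combination y 0 * hz + V * y 1 * y 2 * y 3 * z * h2
  · linear_combination y 1 * hz + y 0 * y 2 * y 3 * z * h2
  · linear_combination y 2 * hz
  · linear_combination y 3 * hz

theorem mem_sqSubfield {x : F} : x ∈ sqSubfield F ↔ ∃ y, y ^ 2 = x := by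
  constructor
  · intro h
    have hle : sqSubfield F ≤ (frobenius F 2).fieldRange :=
      Subfield.closure_le.2 (by rintro _ ⟨y, rfl⟩; exact ⟨y, rfl⟩)
    exact hle h
  · rintro ⟨y, rfl⟩
    exact Subfield.subset_closure ⟨y, rfl⟩

theorem anisotropic_diagQF_of_neighbour {a u b : F}
    (h : (diagQF ![a, a * u, b]).Anisotropic) :
    (diagQF ![a, a * u, b, u * b]).Anisotropic := by
  have h3 : ∀ x y z : F, a * x ^ 2 + a * u * y ^ 2 + b * z ^ 2 = 0 → x = 0 ∧ y = 0 ∧ z = 0 := by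
    intro x y z hxyz
    have := h ![x, y, z] (by simpa [diagQF_apply, Fin.sum_univ_three] using hxyz)
    exact ⟨congrFun this 0, congrFun this 1, congrFun this 2⟩
  intro x hx
  have h2 : (2 : F) = 0 := CharTwo.two_eq_zero
  simp only [diagQF_apply, Fin.sum_univ_four, Matrix.cons_val] at hx
  have hm : x 2 ^ 2 + u * x 3 ^ 2 = 0 := by
    refine (h3 (x 0 * x 2 + u * x 1 * x 3) (x 0 * x 3 + x 1 * x 2) _ ?_).2.2
    linear_combination (x 2 ^ 2 + u * x 3 ^ 2) * hx
      + (2 * a * u * x 0 * x 1 * x 2 * x 3) * h2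
  obtain ⟨e2, e3, -⟩ := h3 (x 2) (x 3) 0 (by linear_combination a * hm)
  rw [e2, e3] at hx
  obtain ⟨e0, e1, -⟩ := h3 (x 0) (x 1) 0 (by linear_combination hx)
  ext i
  fin_cases i <;> assumption

theorem exists_eq_of_normDegree_eq_four {a u b e : F} {n : ℕ} {c : Fin n → F} (ha : a ≠ 0)
    (h : (diagQF ![a, a * u, b]).Anisotropic) (hnd : normDegree F c = 4)
    (h1 : ∃ x, diagQF c x = a) (hu : ∃ x, diagQF c x = a * u) (hb : ∃ x, diagQF c x = b)
    (he : ∃ x, diagQF c x = e) :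
    ∃ x : Fin 4 → F, e = diagQF ![a, a * u, b, u * b] x := by
  set N := IntermediateField.adjoin (sqSubfield F)
    (Set.range fun p : Fin n × Fin n => c p.1 * c p.2) with hN
  have hsq : ∀ x : F, x ^ 2 ∈ N := fun x =>
    N.algebraMap_mem ⟨x ^ 2, mem_sqSubfield.2 ⟨x, rfl⟩⟩
  obtain ⟨x₁, hx₁⟩ := h1
  have hmem : ∀ y, (∃ x, diagQF c x = y) → y / a ∈ N := by
    rintro _ ⟨x, rfl⟩
    have : diagQF c x / a = ∑ i, ∑ j, c i * c j * (x i * x₁ j * a⁻¹) ^ 2 := by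
      have e1 : diagQF c x / a = diagQF c x * diagQF c x₁ * a⁻¹ ^ 2 := by
        rw [hx₁]; field_simp
      rw [e1, diagQF_apply, diagQF_apply, Finset.sum_mul_sum, Finset.sum_mul]
      refine Finset.sum_congr rfl fun i _ => ?_
      rw [Finset.sum_mul]
      exact Finset.sum_congr rfl fun j _ => by ring
    rw [this]
    exact sum_mem fun i _ => sum_mem fun j _ => mul_mem
      (IntermediateField.subset_adjoin _ _ ⟨(i, j), rfl⟩) (hsq _)
  have huN : u ∈ N := by simpa [ha] using hmem _ hu
  have hbN : b / a ∈ N := hmem _ hb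
  let w : Fin 4 → N := ![1, ⟨u, huN⟩, ⟨b / a, hbN⟩, ⟨u, huN⟩ * ⟨b / a, hbN⟩]
  have hcoe : ∀ g : Fin 4 → sqSubfield F, ((∑ i, g i • w i : N) : F)
      = g 0 + g 1 * u + g 2 * (b / a) + g 3 * (u * (b / a)) := by
    intro g
    rw [Fin.sum_univ_four]
    simp [w, Algebra.smul_def]
    rfl
  have hroot : ∀ g : Fin 4 → sqSubfield F, ∃ x : Fin 4 → F, ∀ i, x i ^ 2 = (g i : F) := by
    intro g
    choose x hx using fun i => mem_sqSubfield.1 (g i).2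
    exact ⟨x, hx⟩
  have hval : ∀ (g : Fin 4 → sqSubfield F) (x : Fin 4 → F), (∀ i, x i ^ 2 = (g i : F)) →
      diagQF ![a, a * u, b, u * b] x = a * ((∑ i, g i • w i : N) : F) := by
    intro g x hx
    rw [hcoe, diagQF_apply, Fin.sum_univ_four, ← hx, ← hx, ← hx, ← hx]
    simp only [Matrix.cons_val]
    field_simp
  have hli : LinearIndependent (sqSubfield F) w := by
    rw [Fintype.linearIndependent_iff]
    intro g hg i
    obtain ⟨x, hx⟩ := hroot g
    have := anisotropic_diagQF_of_neighbour h x (by rw [hval g x hx, hg]; simp)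
    ext
    rw [← hx, this]
    simp
  have : FiniteDimensional (sqSubfield F) N :=
    Module.finite_of_finrank_pos (hnd.symm ▸ four_pos : 0 < normDegree F c)
  have hspan := hli.span_eq_top_of_card_eq_finrank' (by simpa [normDegree] using hnd.symm)
  have htop : (⟨e / a, hmem _ he⟩ : N) ∈ Submodule.span (sqSubfield F) (Set.range w) := by
    rw [hspan]; trivial
  obtain ⟨g, hg⟩ := (Submodule.mem_span_range_iff_exists_fun _).1 htop
  obtain ⟨x, hx⟩ := hroot g
  refine ⟨x, ?_⟩
  rw [hval g x hx, hg]
  field_simp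

theorem prod_equivalent_diagQF {n : ℕ} {d : Fin n → F} {e t : F} {x : Fin n → F}
    (h : ((diagQF d).prod (diagQF ![e])).Anisotropic) {y : F}
    (he : e = diagQF d x + t * y ^ 2) :
    ((diagQF d).prod (diagQF ![e])).Equivalent (diagQF (Fin.snoc d t : Fin (n + 1) → F)) := by
  have h2 : (2 : F) = 0 := CharTwo.two_eq_zero
  have hy : y ≠ 0 := by
    rintro rfl
    have := h (x, ![1]) (by
      rw [QuadraticMap.prod_apply, diagQF_apply ![e]]
      simp only [Fin.sum_univ_one, Matrix.cons_val]
      linear_combination -he + e * h2)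
    simpa using congrFun (congrArg Prod.snd this) 0
  refine ⟨⟨{ toFun := fun p => Fin.snoc (fun i => p.1 i + x i * p.2 0) (y * p.2 0)
             map_add' := ?_
             map_smul' := ?_
             invFun := fun z => (fun i => z i.castSucc - x i * (z (Fin.last n) / y),
               fun _ => z (Fin.last n) / y)
             left_inv := ?_
             right_inv := ?_ }, ?_⟩⟩
  · intro p q
    ext i
    refine Fin.lastCases ?_ (fun i => ?_) i <;> simp <;> ring
  · intro r p
    ext i
    refine Fin.lastCases ?_ (fun i => ?_) i <;> simp <;> ring
  · intro p
    ext i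
    · simp [hy]
    · simp [hy, Subsingleton.elim i 0]
  · intro z
    ext i
    refine Fin.lastCases ?_ (fun i => ?_) i <;> simp
    field_simp
  · intro p
    simp only [diagQF_apply, QuadraticMap.prod_apply, Fin.sum_univ_castSucc, Fin.snoc_castSucc,
      Fin.snoc_last, Finset.univ_eq_empty, Finset.sum_empty, zero_add] at he ⊢
    have e1 : ∀ i, d i * (p.1 i + x i * p.2 0) ^ 2
        = d i * p.1 i ^ 2 + d i * x i ^ 2 * p.2 0 ^ 2 := fun i => by
      linear_combination (d i * p.1 i * x i * p.2 0) * h2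
    simp only [e1, Finset.sum_add_distrib, ← Finset.sum_mul]
    simp [he]
    ring

omit [CharP F 2] in
theorem eq_diagQF_of_map_add {Q : QuadraticForm F (Fin n → F)}
    (h : ∀ x y, Q (x + y) = Q x + Q y) : Q = diagQF fun i => Q (Pi.single i 1) := by
  ext x
  let f : (Fin n → F) →+ F := ⟨⟨Q, map_zero Q⟩, h⟩
  have hx : x = ∑ i, x i • (Pi.single i 1 : Fin n → F) := by
    ext i; simp [Pi.single_apply]
  have h1 : Q x = f (∑ i, x i • (Pi.single i 1 : Fin n → F)) := by rw [← hx]; rfl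
  rw [h1, map_sum, diagQF_apply]
  refine Finset.sum_congr rfl fun i _ => ?_
  change Q _ = _
  rw [QuadraticMap.map_smul, smul_eq_mul]
  ring

theorem diagQF_map_add (c x y : Fin n → F) :
    diagQF c (x + y) = diagQF c x + diagQF c y := by
  simp only [diagQF_apply, ← Finset.sum_add_distrib, Pi.add_apply, CharTwo.add_sq, mul_add]

theorem qfPoly_diagQF (c : Fin n → F) : qfPoly F (diagQF c) = diagPoly c := by
  have h : ∀ i j, coeffMat F (diagQF c) i j = if i = j then c i else 0 := by
    intro i j
    have hp : polar (diagQF c) (Pi.single i 1) (Pi.single j 1) = 0 := by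
      rw [QuadraticMap.polar, diagQF_map_add]; ring
    simp only [coeffMat, Matrix.of_apply, hp, ite_self]
    refine if_congr Iff.rfl ?_ rfl
    simp [diagQF_apply, Pi.single_apply]
  simp [qfPoly, diagPoly, h, apply_ite C, ite_mul, pow_two]

theorem not_anisotropic_funField_diagQF_iff {m : ℕ} (φ : QuadraticForm F (Fin m → F))
    (c : Fin n → F) : ¬ (extendQF F (funFieldMap F (diagQF c)) φ).Anisotropic ↔
      IsotropicOver (coeffMat F φ) (DiagRing c) := by
  have h : ¬ (extendQF F (funFieldMap F (diagQF c)) φ).Anisotropic ↔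
      IsotropicOver (coeffMat F φ) (MvPolynomial (Fin n) F ⧸ Ideal.span {qfPoly F (diagQF c)}) :=
    (not_anisotropic_extendQF_iff φ (A := FractionRing
      (MvPolynomial (Fin n) F ⧸ Ideal.span {qfPoly F (diagQF c)}))).trans
      isotropicOver_fractionRing_iff
  rwa [qfPoly_diagQF] at h

end Field

end QuadricFunctionField

open QuadricFunctionField in
theorem stmt9 (F : Type) [Field F] [CharP F 2]
    (φ : QuadraticForm F (Fin 5 → F)) (hφa : φ.Anisotropic) (hφt : HasTypeRS φ 1 3)
    (hφpn : ¬ IsPfisterNeighbour φ)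
    (ψ : QuadraticForm F (Fin 4 → F)) (hψa : ψ.Anisotropic)
    (c : Fin 4 → F) (hc : ψ.Equivalent (diagQF c)) (hnd : normDegree F c = 4)
    (ψ' : QuadraticForm F (Fin 3 → F)) (c0 : F)
    (hsub : ψ.Equivalent (ψ'.prod (diagQF ![c0]))) :
    (¬ (extendQF F (funFieldMap F ψ) φ).Anisotropic ↔
      ¬ (extendQF F (funFieldMap F ψ') φ).Anisotropic) := by
  have hψadd : ∀ x y, ψ (x + y) = ψ x + ψ y := by
    obtain ⟨e⟩ := hc
    intro x y
    rw [← e.map_app, ← e.map_app x, ← e.map_app y, ← diagQF_map_add]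
    exact congrArg _ (map_add e.toLinearEquiv x y)
  have hprod : ∀ p, ∃ x, diagQF c x = (ψ'.prod (diagQF ![c0])) p := by
    obtain ⟨e⟩ := hsub.symm.trans hc
    exact fun p => ⟨e p, e.map_app p⟩
  have hprod' : ∀ p, ∃ x, ψ x = (ψ'.prod (diagQF ![c0])) p ∧ (x = 0 → p = 0) := by
    obtain ⟨e⟩ := hsub.symm
    exact fun p => ⟨e p, e.map_app p, fun h => e.toLinearEquiv.map_eq_zero_iff.1 h⟩
  have hprodA : (ψ'.prod (diagQF ![c0])).Anisotropic := by
    intro p hp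
    obtain ⟨x, hx, hx0⟩ := hprod' p
    exact hx0 (hψa x (hx.trans hp))
  have hψ'add : ∀ x y, ψ' (x + y) = ψ' x + ψ' y := by
    obtain ⟨e⟩ := hsub.symm
    have hv : ∀ x, ψ' x = ψ (e (x, 0)) := fun x => by
      rw [e.map_app, QuadraticMap.prod_apply]; simp
    intro x y
    rw [hv, hv x, hv y, ← hψadd]
    refine congrArg ψ ((congrArg e ?_).trans (map_add e.toLinearEquiv (x, 0) (y, 0)))
    simp
  have hψ'a : ψ'.Anisotropic := fun x hx =>
    congrArg Prod.fst (hprodA (x, 0) (by rw [QuadraticMap.prod_apply, hx]; simp))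
  obtain ⟨p, rfl⟩ : ∃ p, ψ = diagQF p := ⟨_, eq_diagQF_of_map_add hψadd⟩
  obtain ⟨d, rfl⟩ : ∃ d, ψ' = diagQF d := ⟨_, eq_diagQF_of_map_add hψ'add⟩
  have hd0 : d 0 ≠ 0 := fun h => by
    have := congrFun (hψ'a (Pi.single 0 1) (by simp [diagQF_apply, Fin.sum_univ_three, h])) 0
    simp at this
  obtain ⟨a, u, b, ha, rfl⟩ : ∃ a u b, a ≠ 0 ∧ d = ![a, a * u, b] := by
    refine ⟨d 0, d 1 / d 0, d 2, hd0, ?_⟩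
    ext i
    fin_cases i <;> simp
    field_simp
  have hrep : ∀ x : Fin 3 → F, ∃ y, diagQF c y = diagQF ![a, a * u, b] x := fun x => by
    simpa [QuadraticMap.prod_apply] using hprod (x, 0)
  obtain ⟨x, hx⟩ := exists_eq_of_normDegree_eq_four ha hψ'a hnd
    (by simpa [diagQF_apply, Fin.sum_univ_three] using hrep (Pi.single 0 1))
    (by simpa [diagQF_apply, Fin.sum_univ_three] using hrep (Pi.single 1 1))
    (by simpa [diagQF_apply, Fin.sum_univ_three] using hrep (Pi.single 2 1))
    (e := c0) (by simpa [diagQF_apply] using hprod (0, ![1]))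
  have hsplit : c0 = diagQF ![a, a * u, b] (fun i => x i.castSucc) + u * b * x 3 ^ 2 := by
    rw [hx, diagQF_apply, diagQF_apply, Fin.sum_univ_castSucc]
    congr 1
  have hequiv := hsub.trans (prod_equivalent_diagQF hprodA hsplit)
  have hsnoc : (Fin.snoc ![a, a * u, b] (u * b) : Fin 4 → F) = ![a, a * u, b, u * b] := by
    ext i
    fin_cases i <;> rfl
  rw [hsnoc] at hequiv
  rw [not_anisotropic_funField_diagQF_iff, not_anisotropic_funField_diagQF_iff]
  constructor
  · exact fun h => isotropicOver_neighbour_of_isotropicOver ha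
      (isotropicOver_diagRing_of_equivalent hequiv h)
  · exact fun h => isotropicOver_diagRing_of_equivalent hequiv.symm
      (isotropicOver_of_isotropicOver_neighbour ha h)
end

section
/- Let F be a field of characteristic 2, let φ be an anisotropic quadratic form over F, and let ψ be an anisotropic totally singular quadratic form over F of type (0,2). Then φ_{F(ψ)} is isotropic if and only if ψ is weakly dominated by φ, i.e. ψ ≺_w φ. -/
open QuadraticMap MvPolynomial
open scoped TensorProduct

set_option synthInstance.maxHeartbeats 1000000
set_option maxHeartbeats 1000000


section ScalarExtension

variable {F K L : Type} [Field F] [CommRing K] [CommRing L] {n : ℕ}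

theorem extendQF_apply (f : F →+* K) (φ : QuadraticForm F (Fin n → F)) (u : Fin n → K) :
    extendQF F f φ u = ∑ i, ∑ j, u i * u j * f (coeffMat F φ i j) := by
  unfold extendQF Matrix.toQuadraticMap' Matrix.toQuadraticForm'
  rw [LinearMap.BilinMap.toQuadraticMap_apply, Matrix.toLinearMap₂'_apply]
  simp [mul_assoc]

theorem apply_eq_sum_coeffMat (φ : QuadraticForm F (Fin n → F)) (v : Fin n → F) :
    φ v = ∑ i, ∑ j, v i * v j * coeffMat F φ i j := by
  conv_lhs => rw [← φ.toQuadraticMap_toBilin (Pi.basisFun F (Fin n))]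
  rw [LinearMap.BilinMap.toQuadraticMap_apply,
    ← LinearMap.sum_repr_mul_repr_mul (Pi.basisFun F (Fin n)) (Pi.basisFun F (Fin n)) v v]
  have h (i j : Fin n) : φ.toBilin (Pi.basisFun F (Fin n)) (Pi.single i 1) (Pi.single j 1) =
      coeffMat F φ i j := by
    simpa [coeffMat] using φ.toBilin_apply (Pi.basisFun F (Fin n)) i j
  simp [Finsupp.sum_fintype, h, mul_assoc]

theorem map_extendQF (f : F →+* K) (g : K →+* L) (φ : QuadraticForm F (Fin n → F))
    (u : Fin n → K) :
    g (extendQF F f φ u) = extendQF F (g.comp f) φ (g ∘ u) := by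
  simp [extendQF_apply]

theorem extendQF_comp (f : F →+* K) (φ : QuadraticForm F (Fin n → F)) (v : Fin n → F) :
    extendQF F f φ (f ∘ v) = f (φ v) := by
  simp [extendQF_apply, apply_eq_sum_coeffMat φ v]

theorem extendQF_smul_add_smul (f : F →+* K) (φ : QuadraticForm F (Fin n → F))
    (x y : K) (v w : Fin n → F) :
    extendQF F f φ (x • (f ∘ v) + y • (f ∘ w)) =
      x ^ 2 * f (φ v) + y ^ 2 * f (φ w) + x * y * f (polar φ v w) := by
  have h : polar (extendQF F f φ) (f ∘ v) (f ∘ w) = f (polar φ v w) := by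
    have hadd : f ∘ v + f ∘ w = f ∘ (v + w) := by ext i; simp
    simp only [polar, hadd, extendQF_comp, map_sub]
  rw [QuadraticMap.map_add (extendQF F f φ), QuadraticMap.map_smul, QuadraticMap.map_smul,
    extendQF_comp, extendQF_comp, polar_smul_left, polar_smul_right, h]
  simp only [smul_eq_mul]
  ring

/-- An isotropic vector over a polynomial ring yields one over the ring of coefficients,
namely its vector of leading coefficients. -/
theorem exists_extendQF_coeff_eq_zero (f : F →+* K) (φ : QuadraticForm F (Fin n → F))
    (u : Fin n → Polynomial K) (hu : u ≠ 0) (h : extendQF F (Polynomial.C.comp f) φ u = 0) :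
    ∃ N, (fun i => (u i).coeff N) ≠ 0 ∧ extendQF F f φ (fun i => (u i).coeff N) = 0 := by
  obtain ⟨i₁, hi₁⟩ := Function.ne_iff.mp hu
  have : Nonempty (Fin n) := ⟨i₁⟩
  obtain ⟨i₀, hi₀⟩ := Finite.exists_max fun i => (u i).degree
  have hne : u i₀ ≠ 0 := by
    intro h0
    have h1 := hi₀ i₁
    rw [h0, Polynomial.degree_zero, le_bot_iff, Polynomial.degree_eq_bot] at h1
    exact hi₁ h1
  have hdeg (i : Fin n) : (u i).natDegree ≤ (u i₀).natDegree :=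
    Polynomial.natDegree_le_natDegree (hi₀ i)
  refine ⟨(u i₀).natDegree, fun h0 => ?_, ?_⟩
  · exact hne (Polynomial.leadingCoeff_eq_zero.mp (congrFun h0 i₀))
  · have h2 := congrArg (fun p => Polynomial.coeff p ((u i₀).natDegree + (u i₀).natDegree)) h
    simp only [extendQF_apply, RingHom.comp_apply, Polynomial.finsetSum_coeff,
      Polynomial.coeff_mul_C, Polynomial.coeff_zero] at h2
    rw [extendQF_apply, ← h2]
    refine Finset.sum_congr rfl fun i _ => Finset.sum_congr rfl fun j _ => ?_
    rw [Polynomial.coeff_mul_add_eq_of_natDegree_le (hdeg i) (hdeg j)]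

end ScalarExtension

section TotallySingularPlane

variable {F : Type} [Field F]

theorem polar_eq_zero_of_hasTypeRS [CharP F 2] {V : Type} [AddCommGroup V] [Module F V] {s : ℕ}
    {ψ : QuadraticForm F V} (h : HasTypeRS ψ 0 s) (v w : V) : polar ψ v w = 0 := by
  obtain ⟨a, b, c, ⟨e⟩⟩ := h
  have he (x : V) : ψ x = ∑ i, c i * ((e x).2 i * (e x).2 i) := by
    rw [← e.map_app x]
    simp [binsQF, diagQF, QuadraticMap.weightedSumSquares_apply]
  have hadd : e (v + w) = e v + e w := e.toLinearEquiv.map_add v w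
  simp only [polar, he, hadd, ← Finset.sum_sub_distrib]
  refine Finset.sum_eq_zero fun i _ => ?_
  simp only [Prod.snd_add, Pi.add_apply]
  linear_combination c i * (e v).2 i * (e w).2 i * CharTwo.two_eq_zero (R := F)

variable {ψ : QuadraticForm F (Fin 2 → F)}

theorem apply_eq_of_polar_eq_zero (hψ : ∀ v w, polar ψ v w = 0) (v : Fin 2 → F) :
    ψ v = v 0 ^ 2 * ψ (Pi.single 0 1) + v 1 ^ 2 * ψ (Pi.single 1 1) := by
  rw [apply_eq_sum_coeffMat]
  simp [Fin.sum_univ_two, coeffMat, hψ, pow_two]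

theorem qfPoly_eq_of_polar_eq_zero (hψ : ∀ v w, polar ψ v w = 0) :
    qfPoly F ψ = C (ψ (Pi.single 0 1)) * X 0 ^ 2 + C (ψ (Pi.single 1 1)) * X 1 ^ 2 := by
  simp [qfPoly, Fin.sum_univ_two, coeffMat, hψ, pow_two]

/-- Modulo `x² - d·y²`, every polynomial in `x` and `y` is of the form `p(y) + x·q(y)`. -/
theorem exists_eq_add_X_mul_add (d : F) (f : MvPolynomial (Fin 2) F) :
    ∃ (p q : Polynomial F) (r : MvPolynomial (Fin 2) F),
      f = Polynomial.aeval (X 1) p + X 0 * Polynomial.aeval (X 1) q +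
        (X 0 ^ 2 - C d * X 1 ^ 2) * r := by
  induction f using MvPolynomial.induction_on with
  | C c => exact ⟨Polynomial.C c, 0, 0, by simp [MvPolynomial.algebraMap_eq]⟩
  | add f g hf hg =>
    obtain ⟨p, q, r, rfl⟩ := hf
    obtain ⟨p', q', r', rfl⟩ := hg
    exact ⟨p + p', q + q', r + r', by simp only [map_add]; ring⟩
  | mul_X f i hf =>
    obtain ⟨p, q, r, rfl⟩ := hf
    fin_cases i
    · refine ⟨Polynomial.C d * Polynomial.X ^ 2 * q, p,
        Polynomial.aeval (X 1) q + X 0 * r, ?_⟩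
      simp only [map_mul, map_pow, Polynomial.aeval_X, Polynomial.aeval_C,
        MvPolynomial.algebraMap_eq, Fin.zero_eta]
      ring
    · refine ⟨Polynomial.X * p, Polynomial.X * q, X 1 * r, ?_⟩
      simp only [map_mul, Polynomial.aeval_X, Fin.mk_one]
      ring

/-- The canonical map from the polynomial ring to the function field of a quadric. -/
noncomputable def toFunField {m : ℕ} (χ : QuadraticForm F (Fin m → F)) :
    MvPolynomial (Fin m) F →+* FunField F χ :=
  (algebraMap (FunFieldRing F χ) (FunField F χ)).comp
    (Ideal.Quotient.mk (Ideal.span {qfPoly F χ}))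

instance {m : ℕ} (χ : QuadraticForm F (Fin m → F)) :
    IsLocalization (nonZeroDivisors (FunFieldRing F χ)) (FunField F χ) :=
  inferInstanceAs (IsLocalization (nonZeroDivisors (FunFieldRing F χ))
    (FractionRing (FunFieldRing F χ)))

theorem toFunField_eq_zero_iff {m : ℕ} (χ : QuadraticForm F (Fin m → F))
    (f : MvPolynomial (Fin m) F) : toFunField χ f = 0 ↔ qfPoly F χ ∣ f := by
  rw [← Ideal.mem_span_singleton, ← Ideal.Quotient.eq_zero_iff_mem]
  exact map_eq_zero_iff (algebraMap (FunFieldRing F χ) (FunField F χ))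
    (IsLocalization.injective _ le_rfl)

theorem toFunField_comp_C {m : ℕ} (χ : QuadraticForm F (Fin m → F)) :
    (toFunField χ).comp C = funFieldMap F χ := rfl

/-- Common denominators: a nonzero vector over the function field has a nonzero multiple
with polynomial coordinates. -/
theorem exists_toFunField_eq_smul {m n : ℕ} (χ : QuadraticForm F (Fin m → F))
    (u : Fin n → FunField F χ) (hu : u ≠ 0) :
    ∃ (c : FunField F χ) (g : Fin n → MvPolynomial (Fin m) F),
      toFunField χ ∘ g = c • u ∧ c • u ≠ 0 := by
  obtain ⟨b, hb⟩ := IsLocalization.exist_integer_multiples_of_finite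
    (nonZeroDivisors (FunFieldRing F χ)) u
  choose r hr using hb
  choose g hg using fun i => Ideal.Quotient.mk_surjective (I := Ideal.span {qfPoly F χ}) (r i)
  refine ⟨algebraMap (FunFieldRing F χ) _ b, g, ?_, fun h0 => hu ?_⟩
  · ext i
    have h1 : toFunField χ (g i) = algebraMap (FunFieldRing F χ) _ (r i) :=
      congrArg (algebraMap (FunFieldRing F χ) (FunField F χ)) (hg i)
    rw [Function.comp_apply, h1, hr, Algebra.smul_def, Pi.smul_apply, smul_eq_mul]
  · ext i
    exact (IsLocalization.map_units (FunField F χ) b).mul_right_eq_zero.mp (congrFun h0 i)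

section Generic

variable (F) (E : Type) [Field E] [Algebra F E]

/-- The parametrisation `(x, y) ↦ (δ·t, t)` of the quadric `x² = δ²·y²`. -/
noncomputable def lineParam (δ : E) : MvPolynomial (Fin 2) F →ₐ[F] Polynomial E :=
  MvPolynomial.aeval ![Polynomial.C δ * Polynomial.X, Polynomial.X]

variable {F E}

theorem lineParam_aeval_X_one (δ : E) (p : Polynomial F) :
    lineParam F E δ (Polynomial.aeval (X 1) p) = p.map (algebraMap F E) := by
  rw [← Polynomial.aeval_algHom_apply, lineParam, MvPolynomial.aeval_X, Matrix.cons_val_one,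
    Matrix.cons_val_fin_one, Polynomial.aeval_X_left_eq_map]

theorem exists_lineParam_eq {δ : E} {d : F} (hδ : δ ^ 2 = algebraMap F E d)
    (f : MvPolynomial (Fin 2) F) :
    ∃ p q : Polynomial F,
      lineParam F E δ f = p.map (algebraMap F E) +
        Polynomial.C δ * (Polynomial.X * q).map (algebraMap F E) ∧
      (p = 0 → q = 0 → X 0 ^ 2 - C d * X 1 ^ 2 ∣ f) := by
  obtain ⟨p, q, r, rfl⟩ := exists_eq_add_X_mul_add d f
  have h0 : lineParam F E δ (X 0) = Polynomial.C δ * Polynomial.X := by simp [lineParam]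
  have h1 : lineParam F E δ (X 1) = Polynomial.X := by simp [lineParam]
  have hC : lineParam F E δ (C d) = Polynomial.C (δ ^ 2) := by
    rw [hδ]; simp [lineParam, Polynomial.algebraMap_apply]
  refine ⟨p, q, ?_, ?_⟩
  · simp only [map_add, map_mul, map_sub, map_pow, lineParam_aeval_X_one, h0, h1, hC,
      Polynomial.map_mul, Polynomial.map_X]
    ring
  · rintro rfl rfl
    simp

theorem dvd_of_lineParam_eq_zero {δ : E} {d : F} (hδ : δ ^ 2 = algebraMap F E d)
    (hlin : ∀ x y : F, algebraMap F E x + δ * algebraMap F E y = 0 → x = 0 ∧ y = 0)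
    {f : MvPolynomial (Fin 2) F} (hf : lineParam F E δ f = 0) :
    X 0 ^ 2 - C d * X 1 ^ 2 ∣ f := by
  obtain ⟨p, q, h, hdvd⟩ := exists_lineParam_eq hδ f
  rw [hf] at h
  have hc (k : ℕ) : p.coeff k = 0 ∧ (Polynomial.X * q).coeff k = 0 := by
    refine hlin _ _ ?_
    have := congrArg (fun s => Polynomial.coeff s k) h
    simp only [Polynomial.coeff_add, Polynomial.coeff_map, Polynomial.coeff_C_mul,
      Polynomial.coeff_zero] at this
    exact this.symm
  refine hdvd (Polynomial.ext fun k => (hc k).1) (Polynomial.ext fun k => ?_)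
  simpa using (hc (k + 1)).2

end Generic

/-- A polynomial divisible by `qfPoly ψ` and linear in both variables vanishes. -/
theorem eq_zero_of_qfPoly_dvd_linear (hψ : ∀ v w, polar ψ v w = 0) {c d : F}
    (h : qfPoly F ψ ∣ C c * X 0 + C d * X 1) : c = 0 := by
  obtain ⟨r, hr⟩ := h
  rw [qfPoly_eq_of_polar_eq_zero hψ] at hr
  have h1 := congrArg (MvPolynomial.aeval ![Polynomial.X, (0 : Polynomial F)]) hr
  simp only [map_add, map_mul, map_pow, MvPolynomial.aeval_X, MvPolynomial.aeval_C,
    Matrix.cons_val_zero, Matrix.cons_val_one, mul_zero, add_zero, ne_eq, OfNat.ofNat_ne_zero,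
    not_false_eq_true, zero_pow, Polynomial.algebraMap_eq] at h1
  have h2 := congrArg (fun s => Polynomial.coeff s 1) h1
  simpa [mul_assoc, Polynomial.coeff_X_pow_mul'] using h2

theorem not_anisotropic_extendQF_of_weaklyDominated [CharP F 2] {n : ℕ}
    {φ : QuadraticForm F (Fin n → F)} (hψ : ∀ v w, polar ψ v w = 0) (h : WeaklyDominated ψ φ) :
    ¬ (extendQF F (funFieldMap F ψ) φ).Anisotropic := by
  obtain ⟨α, f, hf, hfφ⟩ := h
  have hpolar : polar φ (f (Pi.single 0 1)) (f (Pi.single 1 1)) = 0 := by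
    have := hψ (Pi.single 0 1) (Pi.single 1 1)
    simp only [polar, ← map_add, ← hfφ, smul_apply, ← smul_sub] at this ⊢
    rw [this, smul_zero]
  intro han
  have hv : f (Pi.single 0 1) ≠ 0 := fun h => by
    simpa using congrFun (hf (h.trans (map_zero f).symm)) 0
  obtain ⟨i, hi⟩ := Function.ne_iff.mp hv
  have hz := han
    (toFunField ψ (X 0) • (funFieldMap F ψ ∘ f (Pi.single 0 1)) +
      toFunField ψ (X 1) • (funFieldMap F ψ ∘ f (Pi.single 1 1))) (by
    rw [extendQF_smul_add_smul, hpolar, ← hfφ, ← hfφ, ← toFunField_comp_C]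
    simp only [RingHom.comp_apply, ← map_pow, ← map_mul, ← map_add, toFunField_eq_zero_iff]
    rw [qfPoly_eq_of_polar_eq_zero hψ]
    refine ⟨C (α : F), ?_⟩
    simp only [smul_apply, smul_eq_mul, map_mul, map_zero]
    ring)
  have hzi := congrFun hz i
  rw [← toFunField_comp_C] at hzi
  simp only [Pi.add_apply, Pi.smul_apply, Function.comp_apply, smul_eq_mul, RingHom.comp_apply,
    ← map_mul, ← map_add, Pi.zero_apply, toFunField_eq_zero_iff, mul_comm (X _)] at hzi
  exact hi (eq_zero_of_qfPoly_dvd_linear hψ hzi)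

theorem weaklyDominated_of_apply_eq [CharP F 2] {n : ℕ} {φ : QuadraticForm F (Fin n → F)}
    (hφa : φ.Anisotropic) (hψa : ψ.Anisotropic) (hψ : ∀ v w, polar ψ v w = 0)
    {v w : Fin n → F} (hw : w ≠ 0) (hpolar : polar φ v w = 0)
    (h : ψ (Pi.single 0 1) * φ v = ψ (Pi.single 1 1) * φ w) : WeaklyDominated ψ φ := by
  have h0 : ψ (Pi.single 0 1) ≠ 0 := fun h => by
    simpa using congrFun (hψa _ h) 0
  have hφw : φ w ≠ 0 := fun h => hw (hφa _ h)
  have hα : φ w / ψ (Pi.single 0 1) ≠ 0 := div_ne_zero hφw h0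
  let f : (Fin 2 → F) →ₗ[F] (Fin n → F) :=
    (LinearMap.proj 0).smulRight w + (LinearMap.proj 1).smulRight v
  have hf (x : Fin 2 → F) : (Units.mk0 _ hα : F) • ψ x = φ (f x) := by
    have : f x = x 0 • w + x 1 • v := by simp [f]
    rw [this, QuadraticMap.map_add φ, QuadraticMap.map_smul, QuadraticMap.map_smul,
      polar_smul_left, polar_smul_right, polar_comm, hpolar, apply_eq_of_polar_eq_zero hψ x]
    simp only [Units.val_mk0, smul_eq_mul]
    field_simp
    linear_combination -x 1 ^ 2 * h
  refine ⟨Units.mk0 _ hα, f, ?_, hf⟩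
  rw [← LinearMap.ker_eq_bot, LinearMap.ker_eq_bot']
  intro x hx
  refine hψa x ?_
  have := hf x
  rw [hx, map_zero, smul_eq_mul] at this
  exact (mul_eq_zero.mp this).resolve_left (Units.ne_zero _)

theorem weaklyDominated_of_not_anisotropic_extendQF [CharP F 2] {n : ℕ}
    {φ : QuadraticForm F (Fin n → F)}
    (hφa : φ.Anisotropic) (hψa : ψ.Anisotropic) (hψ : ∀ v w, polar ψ v w = 0)
    (h : ¬ (extendQF F (funFieldMap F ψ) φ).Anisotropic) : WeaklyDominated ψ φ := by
  have h0 : ψ (Pi.single 0 1) ≠ 0 := fun h => by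
    simpa using congrFun (hψa _ h) 0
  obtain ⟨d, hd⟩ : ∃ d, ψ (Pi.single 0 1) * d = ψ (Pi.single 1 1) :=
    ⟨_, mul_div_cancel₀ _ h0⟩
  obtain ⟨δ, hδ⟩ := IsAlgClosed.exists_pow_nat_eq
    (algebraMap F (AlgebraicClosure F) d) (n := 2) two_pos
  have hP : qfPoly F ψ = C (ψ (Pi.single 0 1)) * (X 0 ^ 2 - C d * X 1 ^ 2) := by
    rw [qfPoly_eq_of_polar_eq_zero hψ, ← hd, CharTwo.sub_eq_add, C_mul]
    ring
  have hlin (x y : F) (hxy : algebraMap F (AlgebraicClosure F) x +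
      δ * algebraMap F (AlgebraicClosure F) y = 0) : x = 0 ∧ y = 0 := by
    have hsq : x ^ 2 = d * y ^ 2 := by
      apply (algebraMap F (AlgebraicClosure F)).injective
      simp only [map_mul, map_pow, ← hδ]
      linear_combination
        (algebraMap F (AlgebraicClosure F) x - δ * algebraMap F (AlgebraicClosure F) y) * hxy
    have hz := hψa ![x, y] (by
      rw [apply_eq_of_polar_eq_zero hψ, ← hd]
      simp only [Matrix.cons_val_zero, Matrix.cons_val_one, hsq]
      linear_combination d * y ^ 2 * ψ (Pi.single 0 1) * CharTwo.two_eq_zero (R := F))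
    exact ⟨congrFun hz 0, congrFun hz 1⟩
  have hker {g : MvPolynomial (Fin 2) F} (hg : lineParam F (AlgebraicClosure F) δ g = 0) :
      qfPoly F ψ ∣ g := by
    rw [hP, ((Ne.isUnit h0).map C).mul_left_dvd]
    exact dvd_of_lineParam_eq_zero hδ hlin hg
  have hlineP : lineParam F (AlgebraicClosure F) δ (qfPoly F ψ) = 0 := by
    rw [hP]
    simp [lineParam, Polynomial.algebraMap_apply, ← hδ, mul_pow]
  simp only [QuadraticMap.Anisotropic, not_forall] at h
  obtain ⟨u, hu, hu0⟩ := h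
  obtain ⟨c, g, hg, hcu⟩ := exists_toFunField_eq_smul ψ u hu0
  have hφg : qfPoly F ψ ∣ extendQF F C φ g := by
    rw [← toFunField_eq_zero_iff, map_extendQF, toFunField_comp_C, hg, QuadraticMap.map_smul, hu,
      smul_zero]
  have hcomp : ((lineParam F (AlgebraicClosure F) δ).toRingHom.comp C) =
      Polynomial.C.comp (algebraMap F (AlgebraicClosure F)) :=
    (lineParam F (AlgebraicClosure F) δ).comp_algebraMap
  obtain ⟨N, hN0, hN⟩ := exists_extendQF_coeff_eq_zero (algebraMap F (AlgebraicClosure F)) φ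
    (lineParam F (AlgebraicClosure F) δ ∘ g)
    (fun hz => hcu (by
      rw [← hg]
      ext i
      exact (toFunField_eq_zero_iff _ _).mpr (hker (congrFun hz i))))
    (by
      have := map_extendQF C (lineParam F (AlgebraicClosure F) δ).toRingHom φ g
      rw [hcomp] at this
      refine this.symm.trans ?_
      obtain ⟨r, hr⟩ := hφg
      rw [hr, map_mul]
      exact mul_eq_zero_of_left hlineP _)
  choose p q hpq _ using fun i => exists_lineParam_eq hδ (g i)
  have hvec : (fun i => ((lineParam F (AlgebraicClosure F) δ ∘ g) i).coeff N) =
      (1 : AlgebraicClosure F) • (algebraMap F _ ∘ fun i => (p i).coeff N) +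
        δ • (algebraMap F _ ∘ fun i => (Polynomial.X * q i).coeff N) := by
    ext i
    simp only [Function.comp_apply, hpq, Polynomial.coeff_add, Polynomial.coeff_map,
      Polynomial.coeff_C_mul, Pi.add_apply, Pi.smul_apply, smul_eq_mul, one_mul]
  rw [hvec] at hN hN0
  generalize (fun i => (p i).coeff N) = v at hN hN0
  generalize (fun i => (Polynomial.X * q i).coeff N) = w at hN hN0
  rw [extendQF_smul_add_smul] at hN
  obtain ⟨hvw, hpolar⟩ := hlin (φ v + d * φ w) (polar φ v w) (by
    rw [← hN, hδ, map_add, map_mul]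
    ring)
  have hvw' : φ v = d * φ w := by
    linear_combination hvw - d * φ w * CharTwo.two_eq_zero (R := F)
  refine weaklyDominated_of_apply_eq hφa hψa hψ (v := v) (w := w) ?_ hpolar ?_
  · rintro rfl
    have hv : v = 0 := hφa v (by simpa using hvw')
    subst hv
    apply hN0
    ext i
    simp
  · rw [hvw', ← hd]
    ring

end TotallySingularPlane

theorem stmt10 (F : Type) [Field F] [CharP F 2] (n : ℕ)
    (φ : QuadraticForm F (Fin n → F)) (hφa : φ.Anisotropic)
    (ψ : QuadraticForm F (Fin 2 → F)) (hψa : ψ.Anisotropic) (hψt : HasTypeRS ψ 0 2) :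
    (¬ (extendQF F (funFieldMap F ψ) φ).Anisotropic ↔ WeaklyDominated ψ φ) := by
  have hψ := polar_eq_zero_of_hasTypeRS hψt
  exact ⟨weaklyDominated_of_not_anisotropic_extendQF hφa hψa hψ,
    not_anisotropic_extendQF_of_weaklyDominated hψ⟩
end

section
/- Let F be a field of characteristic 2, let φ be an anisotropic nonsingular quadratic form over F, and let ψ be a nondefective quadratic form over F of dimension ≥ 2 whose nondefective part is neither of type (0,1) nor isometric to the hyperbolic plane. If φ_{F(ψ)} is hyperbolic (i.e. isometric to an orthogonal sum of hyperbolic planes), then for every a ∈ D_F(φ) and every b ∈ D_F(ψ), the form abψ is dominated by φ, i.e. abψ ≺ φ. -/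
open QuadraticMap MvPolynomial
open scoped TensorProduct

set_option synthInstance.maxHeartbeats 1000000
set_option maxHeartbeats 1000000


section
variable {R S : Type} [CommRing R] [CommRing S]

theorem toBilin'_map (f : R →+* S) {N : ℕ} (M : Matrix (Fin N) (Fin N) R) (x y : Fin N → R) :
    Matrix.toBilin' (M.map f) (fun i => f (x i)) (fun i => f (y i)) =
      f (Matrix.toBilin' M x y) := by
  simp [Matrix.toBilin'_apply]

theorem Polynomial.toBilin'_coeff {K : Type} [Field K] {k : ℕ} (A : Matrix (Fin k) (Fin k) K)
    {d e : ℕ} (x y : Fin k → Polynomial K) (hx : ∀ i, (x i).natDegree ≤ d)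
    (hy : ∀ i, (y i).natDegree ≤ e) :
    (Matrix.toBilin' (A.map Polynomial.C) x y).coeff (d + e) =
      Matrix.toBilin' A (fun i => (x i).coeff d) (fun i => (y i).coeff e) := by
  simp only [Matrix.toBilin'_apply, Polynomial.finsetSum_coeff, Matrix.map_apply]
  refine Finset.sum_congr rfl fun i _ => Finset.sum_congr rfl fun j _ => ?_
  rw [mul_right_comm, mul_comm, Polynomial.coeff_C_mul,
    Polynomial.coeff_mul_add_eq_of_natDegree_le (hx i) (hy j)]
  ring

theorem Polynomial.toBilin'_natDegree_le {K : Type} [Field K] {k : ℕ} (A : Matrix (Fin k) (Fin k) K)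
    {d e : ℕ} (x y : Fin k → Polynomial K) (hx : ∀ i, (x i).natDegree ≤ d)
    (hy : ∀ i, (y i).natDegree ≤ e) :
    (Matrix.toBilin' (A.map Polynomial.C) x y).natDegree ≤ d + e := by
  simp only [Matrix.toBilin'_apply, Matrix.map_apply]
  refine Polynomial.natDegree_sum_le_of_forall_le _ _ fun i _ =>
    Polynomial.natDegree_sum_le_of_forall_le _ _ fun j _ => ?_
  refine (Polynomial.natDegree_mul_le).trans (add_le_add ?_ (hy j))
  refine (Polynomial.natDegree_mul_C_le _ _).trans (hx i)

/-- A vector of polynomials is bounded in degree by its value under an anisotropic form. -/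
theorem Polynomial.natDegree_le_of_toBilin' {K : Type} [Field K] {k : ℕ}
    (A : Matrix (Fin k) (Fin k) K)
    (hA : ∀ x, Matrix.toBilin' A x x = 0 → x = 0) (e : ℕ) (x : Fin k → Polynomial K)
    (h : (Matrix.toBilin' (A.map Polynomial.C) x x).natDegree ≤ e + e) (i) :
    (x i).natDegree ≤ e := by
  have key : ∀ d, (∀ i, (x i).natDegree ≤ e + d) → ∀ i, (x i).natDegree ≤ e := by
    intro d
    induction d with
    | zero => intro h; simpa using h
    | succ d ih =>
      intro hd
      refine ih fun i => ?_
      have h1 := Polynomial.toBilin'_coeff A x x hd hd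
      rw [Polynomial.coeff_eq_zero_of_natDegree_lt (by lia)] at h1
      have h2 := congrFun (hA _ h1.symm) i
      have h3 := hd i
      by_contra hc
      have h4 : (x i).natDegree = e + (d + 1) := by lia
      rw [← h4] at h2
      simp at h2
      simp [h2] at h4
  refine key (Finset.univ.sup fun i => (x i).natDegree) (fun i => ?_) i
  exact (Finset.le_sup (f := fun i => (x i).natDegree) (Finset.mem_univ i)).trans (by lia)

theorem Polynomial.toBilin'_anisotropic {K : Type} [Field K] {k : ℕ} (A : Matrix (Fin k) (Fin k) K)
    (hA : ∀ x, Matrix.toBilin' A x x = 0 → x = 0) (x : Fin k → Polynomial K)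
    (h : Matrix.toBilin' (A.map Polynomial.C) x x = 0) : x = 0 := by
  have h0 := Polynomial.natDegree_le_of_toBilin' A hA 0 x (by simp [h])
  have h1 := Polynomial.toBilin'_coeff A x x h0 h0
  rw [h] at h1
  have h2 := hA _ (by simpa using h1.symm)
  ext1 i
  rw [Polynomial.eq_C_of_natDegree_le_zero (h0 i)]
  simpa using congrFun h2 i

/-- Cassels--Pfister for anisotropic forms in any characteristic, keeping track of the polar
products with constant vectors. -/
theorem Polynomial.cassels_pfister {K : Type} [Field K] {k : ℕ} (A : Matrix (Fin k) (Fin k) K)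
    (hA : ∀ x, Matrix.toBilin' A x x = 0 → x = 0) {J : Type} (c : J → Fin k → K)
    (h : Polynomial K) (ℓ : J → Polynomial K) (g : Polynomial K) (hg : g ≠ 0)
    (u : Fin k → Polynomial K)
    (hu : Matrix.toBilin' (A.map Polynomial.C) u u = g ^ 2 * h)
    (hc : ∀ j, Matrix.toBilin' (A.map Polynomial.C) (fun i => Polynomial.C (c j i)) u +
      Matrix.toBilin' (A.map Polynomial.C) u (fun i => Polynomial.C (c j i)) = g * ℓ j) :
    ∃ y : Fin k → Polynomial K, Matrix.toBilin' (A.map Polynomial.C) y y = h ∧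
      ∀ j, Matrix.toBilin' (A.map Polynomial.C) (fun i => Polynomial.C (c j i)) y +
      Matrix.toBilin' (A.map Polynomial.C) y (fun i => Polynomial.C (c j i)) = ℓ j := by
  induction hd : g.natDegree using Nat.strong_induction_on generalizing g u with
  | _ d ih =>
  obtain ⟨z, r, hzr, hr⟩ : ∃ z r : Fin k → Polynomial K,
      u = g • z + r ∧ ∀ i, (r i).degree < g.degree :=
    ⟨fun i => u i / g, fun i => u i % g,
      _root_.funext fun i => (EuclideanDomain.div_add_mod (u i) g).symm,
      fun i => Polynomial.degree_mod_lt _ hg⟩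
  set B := Matrix.toBilin' (A.map Polynomial.C) with hB
  have hcz : ∀ j, B (fun i => Polynomial.C (c j i)) z + B z (fun i => Polynomial.C (c j i)) = ℓ j ∧
      B (fun i => Polynomial.C (c j i)) r + B r (fun i => Polynomial.C (c j i)) = 0 := by
    intro j
    have h1 := hc j
    rw [hzr] at h1
    simp only [map_add, map_smul, LinearMap.add_apply, LinearMap.smul_apply, smul_eq_mul] at h1
    have h2 : B (fun i => Polynomial.C (c j i)) r + B r (fun i => Polynomial.C (c j i)) =
      g * (ℓ j - (B (fun i => Polynomial.C (c j i)) z + B z (fun i => Polynomial.C (c j i)))) := by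
      linear_combination h1
    have h3 : (B (fun i => Polynomial.C (c j i)) r +
        B r (fun i => Polynomial.C (c j i))).degree < g.degree := by
      rw [Polynomial.degree_eq_natDegree hg, ← Polynomial.mem_degreeLT]
      have hr' : ∀ i, r i ∈ Polynomial.degreeLT K g.natDegree := fun i => by
        rw [Polynomial.mem_degreeLT, ← Polynomial.degree_eq_natDegree hg]; exact hr i
      refine add_mem ?_ ?_ <;> rw [hB, Matrix.toBilin'_apply] <;>
        refine Submodule.sum_mem _ fun i _ => Submodule.sum_mem _ fun i' _ => ?_
      · rw [Matrix.map_apply, ← Polynomial.C_mul, ← Polynomial.smul_eq_C_mul]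
        exact Submodule.smul_mem _ _ (hr' _)
      · rw [Matrix.map_apply, mul_assoc, ← Polynomial.C_mul, mul_comm, ← Polynomial.smul_eq_C_mul]
        exact Submodule.smul_mem _ _ (hr' _)
    have h4 := Polynomial.eq_zero_of_dvd_of_degree_lt ⟨_, h2⟩ h3
    refine ⟨?_, h4⟩
    rw [h4] at h2
    have := (mul_eq_zero.1 h2.symm).resolve_left hg
    linear_combination -this
  rw [hzr] at hu
  simp only [map_add, map_smul, LinearMap.add_apply, LinearMap.smul_apply, smul_eq_mul] at hu
  by_cases hr0 : r = 0
  · refine ⟨z, ?_, fun j => (hcz j).1⟩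
    simp only [hr0, map_zero, LinearMap.zero_apply] at hu
    exact mul_left_cancel₀ (pow_ne_zero 2 hg) (by linear_combination hu)
  · have hBr : B r r ≠ 0 := fun h => hr0 (Polynomial.toBilin'_anisotropic A hA r h)
    have hgd : 0 < g.natDegree := by
      by_contra hc
      apply hr0
      ext1 i
      have := hr i
      rw [Polynomial.degree_eq_natDegree hg, show g.natDegree = 0 by lia] at this
      exact Polynomial.degree_eq_bot.1 (Nat.WithBot.lt_zero_iff.1 this)
    have hrd : ∀ i, (r i).natDegree ≤ g.natDegree - 1 := fun i => by
      by_cases h0 : r i = 0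
      · simp [h0]
      · have := Polynomial.natDegree_lt_natDegree h0 (hr i)
        lia
    have hBd := Polynomial.toBilin'_natDegree_le A r r hrd hrd
    rw [← hB] at hBd
    set g' := g * (h - B z z) - (B z r + B r z) with hg'
    have hgg' : B r r = g * g' := by rw [hg']; linear_combination hu
    have hg'0 : g' ≠ 0 := by rintro h0; simp [h0] at hgg'; exact hBr hgg'
    have hg'd : g'.natDegree < d := by
      rw [hgg', Polynomial.natDegree_mul hg hg'0] at hBd
      lia
    refine ih _ hg'd g' hg'0 (g' • z + (B z z - h) • r) ?_ ?_ rfl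
    · simp only [map_add, map_smul, LinearMap.add_apply, LinearMap.smul_apply, smul_eq_mul]
      rw [hgg']
      linear_combination (B z z - h) * (-g') * hg'
    · intro j
      simp only [map_add, map_smul, LinearMap.add_apply, LinearMap.smul_apply, smul_eq_mul]
      linear_combination g' * (hcz j).1 + (B z z - h) * (hcz j).2

theorem toBilin'_map_of_comp {F : Type} [CommRing F] (e : F →+* R) (e' : F →+* S) (f : R →+* S)
    (he : ∀ a, f (e a) = e' a) {N : ℕ} (M : Matrix (Fin N) (Fin N) F) (x y : Fin N → R) :
    Matrix.toBilin' (M.map e') (fun i => f (x i)) (fun i => f (y i)) =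
      f (Matrix.toBilin' (M.map e) x y) := by
  simp [Matrix.toBilin'_apply, he]

/-- The reflection along `z - z'` takes `z` to `z'` and fixes the vectors whose polar products with
`z` and `z'` agree; this is its effect on the polar products with `y`. -/
theorem exists_reflection {K V : Type} [Field K] [AddCommGroup V] [Module K V]
    (B : LinearMap.BilinForm K V) (hB : ∀ x, B x x = 0 → x = 0) (z z' y : V)
    (hz : B z z = B z' z') :
    ∃ y', B y' y' = B y y ∧ B z' y' + B y' z' = B z y + B y z ∧
      ∀ c, B c z + B z c = B c z' + B z' c → B c y' + B y' c = B c y + B y c := by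
  by_cases hw : B (z - z') (z - z') = 0
  · have := sub_eq_zero.1 (hB _ hw)
    subst this
    exact ⟨y, rfl, rfl, fun _ _ => rfl⟩
  · obtain ⟨s, hs⟩ : ∃ s, s * B (z - z') (z - z') = B (z - z') y + B y (z - z') :=
      ⟨_, div_mul_cancel₀ _ hw⟩
    refine ⟨y - s • (z - z'), ?_, ?_, ?_⟩
    · simp only [map_sub, map_smul, LinearMap.sub_apply, LinearMap.smul_apply, smul_eq_mul] at hs ⊢
      linear_combination s * hs
    · simp only [map_sub, map_smul, LinearMap.sub_apply, LinearMap.smul_apply, smul_eq_mul] at hs ⊢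
      linear_combination hs - s * hz
    · intro c hc
      simp only [map_sub, map_smul, LinearMap.sub_apply, LinearMap.smul_apply, smul_eq_mul] at hs ⊢
      linear_combination -s * hc

/-- The generic point of affine space, with homogenizing last coordinate `1`. -/
noncomputable def genericVec (F : Type) [Field F] (m : ℕ) : Fin (m + 1) → MvPolynomial (Fin m) F :=
  Fin.snoc (α := fun _ => MvPolynomial (Fin m) F) X 1

/-- The field of rational functions in `m` variables. -/
abbrev RatField (F : Type) [Field F] (m : ℕ) : Type := FractionRing (MvPolynomial (Fin m) F)

/-- The inclusion of the constants into the rational functions. -/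
noncomputable abbrev ratInj (F : Type) [Field F] (m : ℕ) : F →+* RatField F m :=
  (algebraMap (MvPolynomial (Fin m) F) (RatField F m)).comp C

/-- Polynomials in `m + 1` variables as polynomials in the first variable over the rational
functions in the others. -/
noncomputable def peelVar (F : Type) [Field F] (m : ℕ) :
    MvPolynomial (Fin (m + 1)) F →+* Polynomial (RatField F m) :=
  (Polynomial.mapRingHom (algebraMap (MvPolynomial (Fin m) F) (RatField F m))).comp
    (finSuccEquiv F m : MvPolynomial (Fin (m + 1)) F →+* _)

theorem peelVar_injective (F : Type) [Field F] (m : ℕ) : Function.Injective (peelVar F m) :=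
  (Polynomial.map_injective _ (IsFractionRing.injective _ _)).comp (finSuccEquiv F m).injective

theorem peelVar_C (F : Type) [Field F] (m : ℕ) (a : F) :
    peelVar F m (C a) = Polynomial.C (ratInj F m a) := by
  simp [peelVar, finSuccEquiv_apply]

theorem peelVar_genericVec_zero (F : Type) [Field F] (m : ℕ) :
    peelVar F m (genericVec F (m + 1) 0) = Polynomial.X := by
  have : genericVec F (m + 1) 0 = X 0 := by
    rw [genericVec, ← Fin.castSucc_zero, Fin.snoc_castSucc]
  simp [peelVar, this, finSuccEquiv_X_zero]

theorem peelVar_genericVec_succ (F : Type) [Field F] (m : ℕ) (i : Fin (m + 1)) :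
    peelVar F m (genericVec F (m + 1) i.succ) =
      Polynomial.C (algebraMap _ (RatField F m) (genericVec F m i)) := by
  refine Fin.lastCases ?_ (fun i => ?_) i
  · simp [peelVar, genericVec, Fin.succ_last]
  · rw [genericVec, Fin.succ_castSucc, Fin.snoc_castSucc, genericVec, Fin.snoc_castSucc]
    simp [peelVar, finSuccEquiv_X_succ]

theorem exists_common_denom {F : Type} [Field F] {m k : ℕ} (y : Fin k → RatField F m) :
    ∃ (g : MvPolynomial (Fin m) F) (u : Fin k → MvPolynomial (Fin m) F), g ≠ 0 ∧
      ∀ i, algebraMap _ (RatField F m) (u i) = algebraMap _ (RatField F m) g * y i := by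
  obtain ⟨b, hb⟩ := IsLocalization.exist_integer_multiples_of_finite
    (nonZeroDivisors (MvPolynomial (Fin m) F)) y
  choose u hu using hb
  refine ⟨b, u, nonZeroDivisors.ne_zero b.2, fun i => ?_⟩
  rw [hu, Algebra.smul_def]

theorem ratField_anisotropic_of_mvPolynomial {F : Type} [Field F] {k : ℕ}
    (A : Matrix (Fin k) (Fin k) F) (m : ℕ)
    (h : ∀ u : Fin k → MvPolynomial (Fin m) F,
      Matrix.toBilin' (A.map (C : F →+* MvPolynomial (Fin m) F)) u u = 0 → u = 0)
    (y : Fin k → RatField F m) (hy : Matrix.toBilin' (A.map (ratInj F m)) y y = 0) : y = 0 := by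
  obtain ⟨g, u, hg, hu⟩ := exists_common_denom y
  have hu' : (fun i => algebraMap _ (RatField F m) (u i)) = algebraMap _ (RatField F m) g • y :=
    funext hu
  have h0 := h u (by
    apply IsFractionRing.injective (MvPolynomial (Fin m) F) (RatField F m)
    rw [← toBilin'_map_of_comp (C : F →+* MvPolynomial (Fin m) F) (ratInj F m) _ (fun _ => rfl),
      hu']
    simp only [map_smul, LinearMap.smul_apply, hy, smul_zero, map_zero])
  ext1 i
  have := hu i
  simpa [h0, hg] using this

theorem mvPolynomial_anisotropic {F : Type} [Field F] {k : ℕ} (A : Matrix (Fin k) (Fin k) F)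
    (hA : ∀ x, Matrix.toBilin' A x x = 0 → x = 0) (m : ℕ) :
    ∀ u : Fin k → MvPolynomial (Fin m) F,
      Matrix.toBilin' (A.map (C : F →+* MvPolynomial (Fin m) F)) u u = 0 → u = 0 := by
  induction m with
  | zero =>
    intro u hu
    have h1 := toBilin'_map_of_comp (C : F →+* MvPolynomial (Fin 0) F) (RingHom.id F)
      (isEmptyAlgEquiv F (Fin 0) : MvPolynomial (Fin 0) F →+* F)
      (fun a => (isEmptyAlgEquiv F (Fin 0)).commutes a) A u u
    rw [hu, map_zero] at h1
    have h2 := hA _ (by simpa using h1)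
    ext1 i
    exact (isEmptyAlgEquiv F (Fin 0)).injective ((congrFun h2 i).trans (map_zero _).symm)
  | succ m ih =>
    intro u hu
    have h1 := Polynomial.toBilin'_anisotropic (A.map (ratInj F m))
      (ratField_anisotropic_of_mvPolynomial A m ih) (fun i => peelVar F m (u i)) (by
        rw [Matrix.map_map]
        have := toBilin'_map_of_comp (C : F →+* MvPolynomial (Fin (m + 1)) F)
          (Polynomial.C.comp (ratInj F m)) (peelVar F m) (peelVar_C F m) A u u
        rw [hu, map_zero] at this
        exact this)
    ext1 i
    apply peelVar_injective F m
    simpa using congrFun h1 i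

theorem ratField_anisotropic {F : Type} [Field F] {k : ℕ} (A : Matrix (Fin k) (Fin k) F)
    (hA : ∀ x, Matrix.toBilin' A x x = 0 → x = 0) (m : ℕ) (y : Fin k → RatField F m)
    (hy : Matrix.toBilin' (A.map (ratInj F m)) y y = 0) : y = 0 :=
  ratField_anisotropic_of_mvPolynomial A m (mvPolynomial_anisotropic A hA m) y hy

end

/-- The form `M` evaluated at a vector `(t, x)`, expanded in powers of `t`. -/
theorem toBilin'_cons {R : Type} [CommRing R] {n : ℕ} (M : Matrix (Fin (n + 1)) (Fin (n + 1)) R)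
    (t : R) (x : Fin n → R) :
    Matrix.toBilin' M (Fin.cons t x : Fin (n + 1) → R) (Fin.cons t x : Fin (n + 1) → R) =
      t ^ 2 * M 0 0 + t * (∑ i, (M 0 i.succ + M i.succ 0) * x i) +
        Matrix.toBilin' (M.submatrix Fin.succ Fin.succ) x x := by
  simp only [Matrix.toBilin'_apply, Fin.sum_univ_succ, Fin.cons_zero, Fin.cons_succ,
    Finset.sum_add_distrib, Finset.mul_sum, Matrix.submatrix_apply, add_mul, mul_add]
  have h1 : ∀ i, t * M 0 (Fin.succ i) * x i = t * (M 0 i.succ * x i) := fun i => by ring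
  have h2 : ∀ i, x i * M (Fin.succ i) 0 * t = t * (M i.succ 0 * x i) := fun i => by ring
  simp only [h1, h2]
  ring

/-- Expansion of a form over `K[X]` at a vector of polynomials of degree at most one. -/
theorem Polynomial.toBilin'_linear {K : Type} [Field K] {k : ℕ} (A : Matrix (Fin k) (Fin k) K)
    (x y x' y' : Fin k → K) :
    Matrix.toBilin' (A.map Polynomial.C)
        (fun i => Polynomial.C (x i) + Polynomial.X * Polynomial.C (y i))
        (fun i => Polynomial.C (x' i) + Polynomial.X * Polynomial.C (y' i)) =
      Polynomial.C (Matrix.toBilin' A x x') +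
      Polynomial.X * Polynomial.C (Matrix.toBilin' A x y' + Matrix.toBilin' A y x') +
        Polynomial.X ^ 2 * Polynomial.C (Matrix.toBilin' A y y') := by
  have h : ∀ z w : Fin k → K, (fun i => Polynomial.C (z i) + Polynomial.X * Polynomial.C (w i)) =
      (fun i => Polynomial.C (z i)) + (Polynomial.X : Polynomial K) • fun i => Polynomial.C (w i) :=
    fun z w => rfl
  rw [h, h]
  simp only [map_add, map_smul, LinearMap.add_apply, LinearMap.smul_apply, smul_eq_mul,
    toBilin'_map]
  ring

theorem Polynomial.eq_of_quadratic_eq {K : Type} [Field K] {a b c a' b' c' : K}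
    (h : Polynomial.C a + Polynomial.X * Polynomial.C b + Polynomial.X ^ 2 * Polynomial.C c =
      Polynomial.C a' + Polynomial.X * Polynomial.C b' + Polynomial.X ^ 2 * Polynomial.C c') :
    a = a' ∧ b = b' ∧ c = c' := by
  have h0 := congrArg (fun p => Polynomial.coeff p 0) h
  have h1 := congrArg (fun p => Polynomial.coeff p 1) h
  have h2 := congrArg (fun p => Polynomial.coeff p 2) h
  simp [Polynomial.coeff_X, Polynomial.coeff_C, Polynomial.coeff_X_pow] at h0 h1 h2
  exact ⟨h0, h1, h2⟩

theorem Polynomial.eq_of_linear_eq {K : Type} [Field K] {a b a' b' : K}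
    (h : Polynomial.C a + Polynomial.X * Polynomial.C b =
      Polynomial.C a' + Polynomial.X * Polynomial.C b') : a = a' ∧ b = b' := by
  have := Polynomial.eq_of_quadratic_eq (c := 0) (c' := 0)
    (congrArg (· + Polynomial.X ^ 2 * Polynomial.C 0) h)
  exact ⟨this.1, this.2.1⟩

theorem genericVec_last (F : Type) [Field F] (m : ℕ) : genericVec F m (Fin.last m) = 1 := by
  simp [genericVec]

/-- Cassels--Pfister, one variable at a time: a vector of rational functions at which an
anisotropic form is a quadratic polynomial, and whose polar products with constant vectors are
affine, can be replaced by an affine one. -/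
theorem ratField_descent {F : Type} [Field F] {k : ℕ} (A : Matrix (Fin k) (Fin k) F)
    (hA : ∀ x, Matrix.toBilin' A x x = 0 → x = 0) (m : ℕ) :
    ∀ (J : Type) (c : J → Fin k → F) (M : Matrix (Fin (m + 1)) (Fin (m + 1)) F)
      (ℓ : J → Fin (m + 1) → F) (y : Fin k → RatField F m),
      Matrix.toBilin' (A.map (ratInj F m)) y y =
        algebraMap _ (RatField F m) (Matrix.toBilin' (M.map C) (genericVec F m) (genericVec F m)) →
      (∀ j, Matrix.toBilin' (A.map (ratInj F m)) (fun i => ratInj F m (c j i)) y +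
        Matrix.toBilin' (A.map (ratInj F m)) y (fun i => ratInj F m (c j i)) =
          algebraMap _ (RatField F m) (∑ i, C (ℓ j i) * genericVec F m i)) →
      ∃ f : (Fin (m + 1) → F) →ₗ[F] (Fin k → F), ∀ z,
        Matrix.toBilin' A (f z) (f z) = Matrix.toBilin' M z z ∧
        ∀ j, Matrix.toBilin' A (c j) (f z) + Matrix.toBilin' A (f z) (c j) = ∑ i, ℓ j i * z i := by
  induction m with
  | zero =>
    intro J c M ℓ y hy hc
    obtain ⟨v, hv⟩ : ∃ v : Fin k → F, ∀ i, ratInj F 0 (v i) = y i := by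
      obtain ⟨g, u, hg, hu⟩ := exists_common_denom y
      obtain ⟨g₀, rfl⟩ := C_surjective (Fin 0) g
      choose u₀ hu₀ using fun i => C_surjective (Fin 0) (u i)
      refine ⟨fun i => u₀ i / g₀, fun i => ?_⟩
      have hg₀ : ratInj F 0 g₀ ≠ 0 := by simpa using hg
      rw [map_div₀, div_eq_iff hg₀, mul_comm]
      exact (congrArg _ (hu₀ i)).trans (hu i)
    obtain rfl : (fun i => ratInj F 0 (v i)) = y := funext hv
    have hgen : genericVec F 0 0 = 1 := genericVec_last F 0
    have h1 : Matrix.toBilin' A v v = M 0 0 := by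
      apply (ratInj F 0).injective
      rw [← toBilin'_map, hy]
      simp [Matrix.toBilin'_apply, hgen]
    have h2 : ∀ j, Matrix.toBilin' A (c j) v + Matrix.toBilin' A v (c j) = ℓ j 0 := by
      intro j
      apply (ratInj F 0).injective
      have := hc j
      rw [toBilin'_map, toBilin'_map, ← map_add] at this
      rw [this]
      simp [hgen]
    refine ⟨(LinearMap.proj 0).smulRight v, fun z => ⟨?_, fun j => ?_⟩⟩
    · simp [h1, Matrix.toBilin'_apply]
      ring
    · simp [← h2]
      ring
  | succ m ih =>
    intro J c M ℓ y hy hc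
    -- clear denominators and pass to polynomials in the first variable
    obtain ⟨g, u, hg, hu⟩ := exists_common_denom y
    have hu' : (fun i => algebraMap _ (RatField F (m + 1)) (u i)) =
        algebraMap _ (RatField F (m + 1)) g • y := funext hu
    have hinj := IsFractionRing.injective (MvPolynomial (Fin (m + 1)) F) (RatField F (m + 1))
    have hQ : Matrix.toBilin' (A.map (C : F →+* MvPolynomial (Fin (m + 1)) F)) u u =
        g ^ 2 * Matrix.toBilin' (M.map C) (genericVec F (m + 1)) (genericVec F (m + 1)) := by
      apply hinj
      rw [← toBilin'_map_of_comp (C : F →+* MvPolynomial (Fin (m + 1)) F) (ratInj F (m + 1)) _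
        (fun _ => rfl), hu']
      simp only [map_smul, LinearMap.smul_apply, hy, smul_eq_mul, map_mul, map_pow]
      ring
    have hP : ∀ j, Matrix.toBilin' (A.map (C : F →+* MvPolynomial (Fin (m + 1)) F))
          (fun i => C (c j i)) u +
        Matrix.toBilin' (A.map (C : F →+* MvPolynomial (Fin (m + 1)) F)) u (fun i => C (c j i)) =
        g * ∑ i, C (ℓ j i) * genericVec F (m + 1) i := by
      intro j
      apply hinj
      rw [map_add, ← toBilin'_map_of_comp (C : F →+* MvPolynomial (Fin (m + 1)) F)
        (ratInj F (m + 1)) _ (fun _ => rfl), ← toBilin'_map_of_comp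
        (C : F →+* MvPolynomial (Fin (m + 1)) F) (ratInj F (m + 1)) _ (fun _ => rfl), hu']
      have := hc j
      simp only [map_smul, LinearMap.smul_apply, smul_eq_mul, map_mul, ← mul_add]
      rw [← this]
      rfl
    have hAE := ratField_anisotropic A hA m
    have hmap : ∀ {N : ℕ} (D : Matrix (Fin N) (Fin N) F)
        (a b : Fin N → MvPolynomial (Fin (m + 1)) F),
        Matrix.toBilin' ((D.map (ratInj F m)).map Polynomial.C) (fun i => peelVar F m (a i))
          (fun i => peelVar F m (b i)) = peelVar F m (Matrix.toBilin' (D.map C) a b) := by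
      intro N D a b
      rw [Matrix.map_map]
      exact toBilin'_map_of_comp (C : F →+* MvPolynomial (Fin (m + 1)) F)
        (Polynomial.C.comp (ratInj F m)) (peelVar F m) (peelVar_C F m) D a b
    obtain ⟨Y, hY, hYc⟩ := Polynomial.cassels_pfister (A.map (ratInj F m)) hAE
      (fun j i => ratInj F m (c j i)) _ _ (peelVar F m g)
      (by simpa using (peelVar_injective F m).ne hg) (fun i => peelVar F m (u i))
      (by rw [hmap, hQ, map_mul, map_pow])
      (fun j => by
        have := congrArg (peelVar F m) (hP j)
        rw [map_add, map_mul, ← hmap, ← hmap] at this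
        simpa only [peelVar_C] using this)
    -- the resulting vector is affine in the first variable
    set x : Fin (m + 1) → RatField F m := fun i => algebraMap _ (RatField F m) (genericVec F m i)
      with hx
    have hgv : (fun i => peelVar F m (genericVec F (m + 1) i)) =
        (Fin.cons Polynomial.X (fun i => Polynomial.C (x i)) :
          Fin (m + 2) → Polynomial (RatField F m)) := by
      ext1 i
      refine Fin.cases ?_ (fun i => ?_) i
      · simp [peelVar_genericVec_zero]
      · simp [peelVar_genericVec_succ, hx]
    rw [← hmap, hgv] at hY
    have hYd := Polynomial.natDegree_le_of_toBilin' (A.map (ratInj F m)) hAE 1 Y (by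
      rw [hY]
      refine Polynomial.toBilin'_natDegree_le _ _ _ ?_ ?_ <;>
      · intro i
        refine Fin.cases ?_ (fun i => ?_) i <;> simp)
    obtain ⟨z0, z1, rfl⟩ : ∃ z0 z1 : Fin k → RatField F m,
        Y = fun i => Polynomial.C (z0 i) + Polynomial.X * Polynomial.C (z1 i) := by
      refine ⟨fun i => (Y i).coeff 0, fun i => (Y i).coeff 1, funext fun i => ?_⟩
      conv_lhs => rw [Polynomial.eq_X_add_C_of_natDegree_le_one (hYd i)]
      ring
    rw [Polynomial.toBilin'_linear, toBilin'_cons] at hY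
    obtain ⟨hq0, hq1, hq2⟩ := Polynomial.eq_of_quadratic_eq (a' := Matrix.toBilin'
      ((M.submatrix Fin.succ Fin.succ).map (ratInj F m)) x x)
      (b' := ∑ i, ratInj F m (M 0 i.succ + M i.succ 0) * x i) (c' := ratInj F m (M 0 0))
      (hY.trans (by
        rw [← toBilin'_map Polynomial.C ((M.submatrix Fin.succ Fin.succ).map (ratInj F m))]
        simp only [map_sum, map_add, map_mul, Matrix.map_apply, Matrix.submatrix_map]
        ring))
    have hYc' : ∀ j, (Matrix.toBilin' (A.map (ratInj F m)) (fun i => ratInj F m (c j i)) z0 +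
          Matrix.toBilin' (A.map (ratInj F m)) z0 (fun i => ratInj F m (c j i)) =
            ∑ i, ratInj F m (ℓ j i.succ) * x i) ∧
        (Matrix.toBilin' (A.map (ratInj F m)) (fun i => ratInj F m (c j i)) z1 +
          Matrix.toBilin' (A.map (ratInj F m)) z1 (fun i => ratInj F m (c j i)) =
            ratInj F m (ℓ j 0)) := by
      intro j
      have h1 := hYc j
      have h2 : (fun i => Polynomial.C (ratInj F m (c j i))) = fun i =>
          Polynomial.C (ratInj F m (c j i)) +
            Polynomial.X * Polynomial.C ((0 : Fin k → RatField F m) i) := by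
        simp
      rw [h2, Polynomial.toBilin'_linear, Polynomial.toBilin'_linear] at h1
      simp only [map_zero, LinearMap.zero_apply] at h1
      refine Polynomial.eq_of_linear_eq (Eq.trans ?_ (h1.trans ?_))
      · simp only [map_add, map_zero]
        ring
      · rw [map_sum, Fin.sum_univ_succ]
        simp only [map_mul, peelVar_C, peelVar_genericVec_zero, peelVar_genericVec_succ, map_sum]
        simp only [hx]
        ring
    -- make the leading coefficient constant
    have hx1 : x (Fin.last m) = 1 := by simp [hx, genericVec_last]
    obtain ⟨f₁, hf₁⟩ := ih J c (Matrix.single (Fin.last m) (Fin.last m) (M 0 0))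
      (fun j => Pi.single (Fin.last m) (ℓ j 0)) z1
      (by rw [hq2]; simp [Matrix.toBilin'_apply, Matrix.single_apply, genericVec_last, ite_and])
      (fun j => by
        rw [(hYc' j).2]
        simp [Pi.single_apply, apply_ite C, genericVec_last])
    set v : Fin k → F := f₁ (Pi.single (Fin.last m) 1) with hv
    have hv1 : Matrix.toBilin' A v v = M 0 0 := by
      rw [hv, (hf₁ _).1]
      simp [Matrix.toBilin'_apply, Matrix.single_apply, Pi.single_apply, ite_and]
    have hv2 : ∀ j, Matrix.toBilin' A (c j) v + Matrix.toBilin' A v (c j) = ℓ j 0 := by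
      intro j
      rw [hv, (hf₁ _).2 j]
      simp [Pi.single_apply]
    obtain ⟨y', hy'q, hy'v, hy'c⟩ := exists_reflection (Matrix.toBilin' (A.map (ratInj F m))) hAE z1
      (fun i => ratInj F m (v i)) z0 (by rw [hq2, toBilin'_map, hv1])
    -- solve the remaining problem in fewer variables
    obtain ⟨f, hf⟩ := ih (Option J) (fun o => o.elim v c) (M.submatrix Fin.succ Fin.succ)
      (fun o i => o.elim (M 0 i.succ + M i.succ 0) (fun j => ℓ j i.succ)) y'
      (by
        rw [hy'q, hq0, ← toBilin'_map_of_comp C (ratInj F m) _ (fun _ => rfl)])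
      (fun o => by
        rw [map_sum]
        cases o with
        | none =>
          simp only [Option.elim_none]
          rw [hy'v, add_comm, hq1]
          simp [hx]
        | some j =>
          simp only [Option.elim_some]
          rw [hy'c _ (by
            rw [(hYc' j).2, toBilin'_map, toBilin'_map, ← map_add, hv2]), (hYc' j).1]
          simp [hx])
    refine ⟨(LinearMap.proj 0).smulRight v + f.comp (LinearMap.funLeft F F Fin.succ), fun z => ?_⟩
    obtain ⟨t, x', rfl⟩ : ∃ t x', z = Fin.cons t x' :=
      ⟨z 0, Fin.tail z, (Fin.cons_self_tail z).symm⟩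
    have hz : LinearMap.funLeft F F Fin.succ (Fin.cons t x' : Fin (m + 2) → F) = x' := by
      ext i
      simp [LinearMap.funLeft_apply]
    have h1 := (hf x').1
    have h2 := (hf x').2 none
    simp only [Option.elim_none] at h2
    simp only [LinearMap.add_apply, LinearMap.smulRight_apply, LinearMap.proj_apply, Fin.cons_zero,
      LinearMap.comp_apply, hz, toBilin'_cons, map_add, map_smul, LinearMap.smul_apply, smul_eq_mul]
    refine ⟨?_, fun j => ?_⟩
    · linear_combination t ^ 2 * hv1 + t * h2 + h1
    · have h3 := (hf x').2 (some j)
      simp only [Option.elim_some] at h3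
      rw [Fin.sum_univ_succ]
      simp only [Fin.cons_zero, Fin.cons_succ]
      linear_combination t * hv2 j + h3

theorem QuadraticMap.map_sum_smul_eq_zero {R V ι : Type} [CommRing R] [AddCommGroup V] [Module R V]
    (Q : QuadraticForm R V) (w : ι → V) (h0 : ∀ i, Q (w i) = 0)
    (h1 : ∀ i j, i ≠ j → polar Q (w i) (w j) = 0) (s : Finset ι) (a : ι → R) :
    Q (∑ i ∈ s, a i • w i) = 0 := by
  classical
  have h2 : ∀ i j, polar Q (w i) (w j) = 0 := fun i j => by
    by_cases h : i = j
    · simp [h, QuadraticMap.polar_self, h0]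
    · exact h1 i j h
  induction s using Finset.induction_on with
  | empty => simp
  | insert i s hi ih =>
    rw [Finset.sum_insert hi, QuadraticMap.map_add Q, ih, QuadraticMap.map_smul, h0,
      ← QuadraticMap.polarBilin_apply_apply]
    simp [h2]

theorem polar_toQuadraticMap'_eq {R : Type} [CommRing R] {n : ℕ} (M : Matrix (Fin n) (Fin n) R)
    (x y : Fin n → R) :
    polar (Matrix.toQuadraticForm' M) x y = Matrix.toBilin' M x y + Matrix.toBilin' M y x :=
  LinearMap.BilinMap.polar_toQuadraticMap _ _

theorem toBilin'_coeffMat {F : Type} [Field F] {n : ℕ} (ψ : QuadraticForm F (Fin n → F))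
    (x : Fin n → F) : Matrix.toBilin' (coeffMat F ψ) x x = ψ x := by
  have h := QuadraticMap.map_sum_smul_eq_zero (Matrix.toQuadraticForm' (coeffMat F ψ) - ψ)
    (fun i => Pi.single i 1) (fun i => ?_) (fun i j hij => ?_) Finset.univ x
  · rw [← pi_eq_sum_univ' x] at h
    exact sub_eq_zero.1 h
  · rw [sub_apply, sub_eq_zero]
    exact (Matrix.toBilin'_single (coeffMat F ψ) i i).trans (by simp [coeffMat])
  · rw [FunLike.coe_sub, sub_eq_add_neg, QuadraticMap.polar_add, QuadraticMap.polar_neg,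
      polar_toQuadraticMap'_eq, Matrix.toBilin'_single, Matrix.toBilin'_single]
    rcases lt_or_gt_of_ne hij with h | h
    · simp [coeffMat, hij, hij.symm, h, h.not_gt]
    · simp [coeffMat, hij, hij.symm, h, h.not_gt, QuadraticMap.polar_comm ψ (Pi.single i 1)]

theorem hypQF_apply {R : Type} [CommRing R] {r : ℕ} (z : Fin r → Fin 2 → R) :
    hypQF R r z = ∑ i, z i 0 * z i 1 := by
  have h : ∀ x : Fin 2 → R, binQF 0 0 x = x 0 * x 1 := fun x =>
    (Matrix.toBilin'_apply (Matrix.of ![![0, 1], ![0, 0]]) x x).trans (by simp [Fin.sum_univ_two])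
  simp [hypQF, binsQF, QuadraticMap.pi_apply, h]

theorem polar_hypQF {R : Type} [CommRing R] {r : ℕ} (z z' : Fin r → Fin 2 → R) :
    polar (hypQF R r) z z' = ∑ i, (z i 0 * z' i 1 + z' i 0 * z i 1) := by
  simp only [polar, hypQF_apply, ← Finset.sum_sub_distrib]
  refine Finset.sum_congr rfl fun i _ => ?_
  simp only [Pi.add_apply]
  ring

/-- A form that becomes hyperbolic over `R` has a half-dimensional totally isotropic subspace
over every field to which `R` maps. -/
theorem exists_isotropic_of_hyperbolic {F : Type} [Field F] {R L : Type} [CommRing R] [Field L]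
    {k r : ℕ} (f : F →+* R) (θ : R →+* L) (φ : QuadraticForm F (Fin k → F))
    (h : (extendQF F f φ).Equivalent (hypQF R r)) :
    k = r * 2 ∧ ∃ W : (Fin r → L) →ₗ[L] (Fin k → L), Function.Injective W ∧
      ∀ s, Matrix.toBilin' ((coeffMat F φ).map (θ.comp f)) (W s) (W s) = 0 := by
  obtain ⟨e⟩ := h
  have : Nontrivial R := θ.domain_nontrivial
  refine ⟨by simpa [Module.finrank_pi_fintype] using e.toLinearEquiv.finrank_eq, ?_⟩
  have he : ∀ z, extendQF F f φ (e.symm z) = hypQF R r z := fun z => e.symm.map_app z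
  have hp : ∀ z z', Matrix.toBilin' ((coeffMat F φ).map f) (e.symm z) (e.symm z') +
      Matrix.toBilin' ((coeffMat F φ).map f) (e.symm z') (e.symm z) = polar (hypQF R r) z z' := by
    intro z z'
    rw [← polar_toQuadraticMap'_eq]
    simp only [polar, ← he, map_add]
    rfl
  set w : Fin r → Fin k → L := fun i j => θ (e.symm (Pi.single i (Pi.single 0 1)) j) with hw
  set w' : Fin r → Fin k → L := fun i j => θ (e.symm (Pi.single i (Pi.single 1 1)) j) with hw'
  have hB := toBilin'_map_of_comp f (θ.comp f) θ (fun _ => rfl) (coeffMat F φ)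
  set B := Matrix.toBilin' ((coeffMat F φ).map (θ.comp f)) with hBdef
  have h0 : ∀ i, B (w i) (w i) = 0 := by
    intro i
    rw [hw]
    simp only
    rw [hB]
    refine (congrArg θ ((he _).trans ?_)).trans (map_zero θ)
    rw [hypQF_apply]
    refine Finset.sum_eq_zero fun j _ => ?_
    by_cases hij : j = i
    · subst hij; simp
    · simp [hij]
  have h1 : ∀ i j, B (w i) (w j) + B (w j) (w i) = 0 := by
    intro i j
    rw [hw]
    simp only
    rw [hB, hB, ← map_add, hp, polar_hypQF]
    refine (congrArg θ (Finset.sum_eq_zero fun l _ => ?_)).trans (map_zero θ)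
    by_cases h : l = i <;> by_cases h' : l = j <;> simp [Pi.single_apply, h, h'] <;>
      (try split_ifs) <;> simp
  have h2 : ∀ i j, B (w i) (w' j) + B (w' j) (w i) = if i = j then 1 else 0 := by
    intro i j
    rw [hw, hw']
    simp only
    rw [hB, hB, ← map_add, hp, polar_hypQF, Finset.sum_eq_single i]
    · by_cases h : i = j
      · subst h; simp
      · simp [h]
    · intro l _ hl
      simp [hl]
    · simp
  refine ⟨Fintype.linearCombination L w, ?_, ?_⟩
  · rw [← LinearMap.ker_eq_bot, LinearMap.ker_eq_bot']
    intro s hs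
    ext1 j
    have h3 : B (Fintype.linearCombination L w s) (w' j) +
        B (w' j) (Fintype.linearCombination L w s) = s j := by
      rw [Fintype.linearCombination_apply]
      simp only [map_sum, map_smul, LinearMap.sum_apply, LinearMap.smul_apply,
        ← Finset.sum_add_distrib, ← smul_add, h2]
      simp
    rw [hs] at h3
    simpa using h3.symm
  · intro s
    refine QuadraticMap.map_sum_smul_eq_zero (Matrix.toQuadraticForm' _) w h0 (fun i j _ => ?_)
      Finset.univ s
    rw [polar_toQuadraticMap'_eq]
    exact h1 i j

/-- Over a quadratic extension `E[t]/(t² + βt + γ)` with a half-dimensional totally isotropic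
subspace, `t² + βt + γ` is a similarity factor of the form over `E(t)`, via a linear vector. -/
theorem exists_similarity_vector {E : Type} [Field E] {k r : ℕ} (A : Matrix (Fin k) (Fin k) E)
    (hA : ∀ x, Matrix.toBilin' A x x = 0 → x = 0) (β γ : E) (hk : k = r * 2)
    (p : Polynomial E)
    (hp : p = Polynomial.X ^ 2 + Polynomial.C β * Polynomial.X + Polynomial.C γ)
    [Fact (Irreducible p)]
    (W : (Fin r → AdjoinRoot p) →ₗ[AdjoinRoot p] (Fin k → AdjoinRoot p))
    (hW : Function.Injective W)
    (hW0 : ∀ s, Matrix.toBilin' (A.map (AdjoinRoot.of p)) (W s) (W s) = 0) (v : Fin k → E) :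
    ∃ y, Matrix.toBilin' A y y = γ * Matrix.toBilin' A v v ∧
      Matrix.toBilin' A y v + Matrix.toBilin' A v y = β * Matrix.toBilin' A v v := by
  have hdeg : p.natDegree = 2 := by rw [hp]; compute_degree!
  have hmon : p.Monic := by rw [hp]; monicity!
  have huniq : ∀ a b : E, AdjoinRoot.of p a + AdjoinRoot.root p * AdjoinRoot.of p b = 0 →
      a = 0 ∧ b = 0 := by
    intro a b h
    have h1 : AdjoinRoot.mk p (Polynomial.C a + Polynomial.X * Polynomial.C b) = 0 := by
      rw [map_add, map_mul, AdjoinRoot.mk_C, AdjoinRoot.mk_X, AdjoinRoot.mk_C]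
      exact h
    rw [AdjoinRoot.mk_eq_zero] at h1
    have h2 := Polynomial.eq_zero_of_dvd_of_natDegree_lt h1 (by
      rw [hdeg]
      refine lt_of_le_of_lt ?_ one_lt_two
      compute_degree)
    exact Polynomial.eq_of_linear_eq (h2.trans (by simp))
  set co : ℕ → AdjoinRoot p →ₗ[E] E := fun i =>
    (Polynomial.lcoeff E i).comp (AdjoinRoot.modByMonicHom hmon) with hco
  have hdecomp : ∀ z, z =
      AdjoinRoot.of p (co 0 z) + AdjoinRoot.root p * AdjoinRoot.of p (co 1 z) := by
    intro z
    obtain ⟨q, rfl⟩ := AdjoinRoot.mk_surjective z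
    have h1 : (AdjoinRoot.modByMonicHom hmon (AdjoinRoot.mk p q)).natDegree ≤ 1 := by
      rw [AdjoinRoot.modByMonicHom_mk]
      have := Polynomial.natDegree_modByMonic_lt q hmon (by rintro rfl; simp at hdeg)
      lia
    conv_lhs => rw [← AdjoinRoot.mk_leftInverse hmon (AdjoinRoot.mk p q),
      Polynomial.eq_X_add_C_of_natDegree_le_one h1]
    simp only [map_add, map_mul, AdjoinRoot.mk_X, AdjoinRoot.mk_C, hco]
    simp only [LinearMap.comp_apply, Polynomial.lcoeff_apply]
    ring
  set Ψ : (Fin r → AdjoinRoot p) →ₗ[E] (Fin k → E) :=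
    (LinearMap.compLeft (co 1) (Fin k)).comp (W.restrictScalars E) with hΨ
  have hΨi : Function.Injective Ψ := by
    rw [← LinearMap.ker_eq_bot, LinearMap.ker_eq_bot']
    intro s hs
    have h1 : W s = fun i => AdjoinRoot.of p (co 0 (W s i)) := by
      ext1 i
      have : co 1 (W s i) = 0 := congrFun hs i
      conv_lhs => rw [hdecomp (W s i), this]
      simp
    have h2 := hW0 s
    rw [h1, toBilin'_map, map_eq_zero] at h2
    have h3 := hA _ h2
    apply hW
    rw [h1, map_zero]
    ext1 i
    have := congrFun h3 i
    simp [this]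
  have hfd : FiniteDimensional E (AdjoinRoot p) := (AdjoinRoot.powerBasis' hmon).finite
  have hfr : Module.finrank E (AdjoinRoot p) = 2 := by
    rw [(AdjoinRoot.powerBasis' hmon).finrank, AdjoinRoot.powerBasis'_dim, hdeg]
  obtain ⟨s, hs⟩ := (LinearMap.injective_iff_surjective_of_finrank_eq_finrank (f := Ψ) (by
    rw [Module.finrank_pi_fintype]
    simp [hfr, hk])).1 hΨi v
  refine ⟨fun i => co 0 (W s i), ?_⟩
  set y : Fin k → E := fun i => co 0 (W s i) with hy
  have h1 : W s = (fun i => AdjoinRoot.of p (y i)) +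
      AdjoinRoot.root p • fun i => AdjoinRoot.of p (v i) := by
    ext1 i
    have : co 1 (W s i) = v i := congrFun hs i
    conv_lhs => rw [hdecomp (W s i), this]
    simp [hy]
  have h2 := hW0 s
  rw [h1] at h2
  simp only [map_add, map_smul, LinearMap.add_apply, LinearMap.smul_apply, smul_eq_mul,
    toBilin'_map] at h2
  have ht : AdjoinRoot.root p ^ 2 + AdjoinRoot.of p β * AdjoinRoot.root p +
      AdjoinRoot.of p γ = 0 := by
    have h : AdjoinRoot.mk p
        (Polynomial.X ^ 2 + Polynomial.C β * Polynomial.X + Polynomial.C γ) = 0 := by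
      rw [← hp]
      exact AdjoinRoot.mk_self
    simpa only [map_add, map_mul, map_pow, AdjoinRoot.mk_X, AdjoinRoot.mk_C] using h
  have h3 := huniq (Matrix.toBilin' A y y - γ * Matrix.toBilin' A v v)
    (Matrix.toBilin' A y v + Matrix.toBilin' A v y - β * Matrix.toBilin' A v v) (by
      simp only [map_add, map_sub, map_mul]
      linear_combination h2 - AdjoinRoot.of p (Matrix.toBilin' A v v) * ht)
  exact ⟨sub_eq_zero.1 h3.1, sub_eq_zero.1 h3.2⟩

theorem MvPolynomial.exists_coeff_one_aeval {F : Type} [Field F] {m : ℕ}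
    (r : MvPolynomial (Fin m) F) :
    ∃ c : Fin m → F, ∀ x : Fin m → F,
      (aeval (fun i => Polynomial.C (x i) * Polynomial.X) r).coeff 1 = ∑ i, c i * x i := by
  induction r using MvPolynomial.induction_on with
  | C a =>
    refine ⟨0, fun x => ?_⟩
    rw [aeval_C, Polynomial.algebraMap_apply, Polynomial.coeff_C]
    simp
  | add p q hp hq =>
    obtain ⟨c, hc⟩ := hp
    obtain ⟨d, hd⟩ := hq
    refine ⟨c + d, fun x => ?_⟩
    simp [hc, hd, add_mul, Finset.sum_add_distrib]
  | mul_X p i hp =>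
    clear hp
    refine ⟨Pi.single i (constantCoeff p), fun x => ?_⟩
    have h : (aeval (fun i => Polynomial.C (x i) * Polynomial.X) p).coeff 0 =
        constantCoeff p := by
      induction p using MvPolynomial.induction_on with
      | C a => simp
      | add p q hp hq => simp_all
      | mul_X p i _ => simp [Polynomial.coeff_zero_eq_eval_zero]
    rw [map_mul, aeval_X, ← mul_assoc, Polynomial.coeff_mul_X, Polynomial.coeff_mul_C, h,
      Finset.sum_eq_single i] <;> simp +contextual

/-- In characteristic two, a polynomial root of `t² + βt + γ`, with `β` a linear and `γ` a
quadratic form in the variables, may be taken to be a linear form. -/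
theorem MvPolynomial.exists_linear_root {F : Type} [Field F] [CharP F 2] {m : ℕ} (β : Fin m → F)
    (G : Matrix (Fin m) (Fin m) F) (ρ : MvPolynomial (Fin m) F)
    (hρ : ρ ^ 2 + (∑ i, C (β i) * X i) * ρ + Matrix.toBilin' (G.map C) X X = 0) :
    ∃ c : Fin m → F, ∀ x, (∑ i, c i * x i) ^ 2 + (∑ i, β i * x i) * (∑ i, c i * x i) +
      Matrix.toBilin' G x x = 0 := by
  obtain ⟨c, hc⟩ := exists_coeff_one_aeval ρ
  refine ⟨c, fun x => ?_⟩
  set e : MvPolynomial (Fin m) F →ₐ[F] Polynomial F :=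
    aeval (fun i => Polynomial.C (x i) * Polynomial.X) with he
  have hG : e (Matrix.toBilin' (G.map C) X X) =
      Polynomial.C (Matrix.toBilin' G x x) * Polynomial.X ^ 2 := by
    simp only [Matrix.toBilin'_apply, map_sum, map_mul, he, aeval_X, Matrix.map_apply, aeval_C,
      Finset.sum_mul, Polynomial.algebraMap_apply, Algebra.algebraMap_self_apply]
    refine Finset.sum_congr rfl fun i _ => Finset.sum_congr rfl fun j _ => ?_
    ring
  have hβ : e (∑ i, C (β i) * X i) = Polynomial.C (∑ i, β i * x i) * Polynomial.X := by
    simp only [map_sum, map_mul, he, aeval_X, aeval_C, Finset.sum_mul,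
      Polynomial.algebraMap_apply, Algebra.algebraMap_self_apply]
    refine Finset.sum_congr rfl fun i _ => ?_
    ring
  have hsq : (e ρ ^ 2).coeff 2 = 2 * ((e ρ).coeff 0 * (e ρ).coeff 2) + (e ρ).coeff 1 ^ 2 := by
    rw [pow_two, Polynomial.coeff_mul]
    simp only [Finset.Nat.antidiagonal_succ, Finset.Nat.antidiagonal_zero, Finset.map_singleton,
      Finset.map_cons, Finset.sum_cons, Finset.sum_singleton]
    simp only [Function.Embedding.prodMap, Function.Embedding.coeFn_mk, Prod.map]
    simp
    ring
  have h := congrArg (fun q => (e q).coeff 2) hρ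
  simp only [map_add, map_mul, map_pow, map_zero, Polynomial.coeff_add, hG, hβ, hsq,
    Polynomial.coeff_zero, Polynomial.coeff_C_mul, mul_assoc, Polynomial.coeff_X_mul,
    Polynomial.coeff_X_pow, if_true, mul_one, CharTwo.two_eq_zero, zero_mul, zero_add] at h
  rw [← hc x]
  exact h

theorem irreducible_quadratic_ratField {F : Type} [Field F] {m : ℕ} (β γ : MvPolynomial (Fin m) F)
    (h : ∀ ρ, ρ ^ 2 + β * ρ + γ ≠ 0) :
    Irreducible ((Polynomial.X ^ 2 + Polynomial.C β * Polynomial.X + Polynomial.C γ).map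
      (algebraMap _ (RatField F m))) := by
  set p : Polynomial (MvPolynomial (Fin m) F) :=
    Polynomial.X ^ 2 + Polynomial.C β * Polynomial.X + Polynomial.C γ with hp
  have hmon : p.Monic := by rw [hp]; monicity!
  have hdeg : p.natDegree = 2 := by rw [hp]; compute_degree!
  rw [← hmon.irreducible_iff_irreducible_map_fraction_map,
    hmon.irreducible_iff_roots_eq_zero_of_degree_le_three hdeg.ge (hdeg.le.trans (by norm_num)),
    Multiset.eq_zero_iff_forall_notMem]
  intro ρ hρ
  refine h ρ ?_
  simpa [hp] using (Polynomial.mem_roots'.1 hρ).2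

/-- A regular form of dimension at least two that splits into linear factors is a hyperbolic
plane. -/
theorem equivalent_hypQF_one_of_eq_mul {F V : Type} [Field F] [AddCommGroup V] [Module F V]
    [FiniteDimensional F V] (Q : QuadraticForm F V) (hV : 2 ≤ Module.finrank F V)
    (hQ : ∀ x, Q x = 0 → (∀ y, polar Q x y = 0) → x = 0) (l l' : V →ₗ[F] F)
    (h : ∀ x, Q x = l x * l' x) : Q.Equivalent (hypQF F 1) := by
  set f : V →ₗ[F] (Fin 1 → Fin 2 → F) :=
    LinearMap.pi fun _ => LinearMap.pi ![l, l'] with hf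
  have hfi : Function.Injective f := by
    rw [← LinearMap.ker_eq_bot, LinearMap.ker_eq_bot']
    intro x hx
    have h0 : l x = 0 := congrFun (congrFun hx 0) 0
    have h1 : l' x = 0 := congrFun (congrFun hx 0) 1
    exact hQ x (by simp [h, h0]) fun y => by simp [polar, h, h0, h1]
  have hle := LinearMap.finrank_le_finrank_of_injective hfi
  have h2 : Module.finrank F (Fin 1 → Fin 2 → F) = 2 := by simp [Module.finrank_pi_fintype]
  have hfs := (LinearMap.injective_iff_surjective_of_finrank_eq_finrank (f := f) (by lia)).1 hfi
  refine ⟨⟨LinearEquiv.ofBijective f ⟨hfi, hfs⟩, fun x => ?_⟩⟩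
  simp [hypQF_apply, hf, h]

theorem eq_zero_of_equivalent_anisotropic_prod_hypQF {F V V' : Type} [Field F] [AddCommGroup V]
    [Module F V] [AddCommGroup V'] [Module F V'] {m : ℕ} (ψ : QuadraticForm F V)
    (ψ' : QuadraticForm F V') (ha : ψ'.Anisotropic) (he : ψ.Equivalent (ψ'.prod (hypQF F m)))
    (x : V) (hx : ψ x = 0) (hp : ∀ y, polar ψ x y = 0) : x = 0 := by
  obtain ⟨e⟩ := he
  have he : ∀ z, (ψ'.prod (hypQF F m)) (e z) = ψ z := fun z => e.map_app z
  have hp' : ∀ y, polar (ψ'.prod (hypQF F m)) (e x) y = 0 := by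
    intro y
    obtain ⟨y, rfl⟩ := e.surjective y
    rw [← hp y]
    simp only [polar, ← he, map_add]
    rfl
  have h2 : (e x).2 = 0 := by
    ext i j
    have h := hp' (0, Pi.single i (Pi.single (1 - j) 1))
    rw [QuadraticMap.polar_prod, polar_hypQF] at h
    rw [Finset.sum_eq_single i (by intro l _ hl; simp [hl]) (by simp)] at h
    fin_cases j <;> simpa using h
  have h1 : (e x).1 = 0 := by
    apply ha
    have := he x
    rw [hx, QuadraticMap.prod_apply, h2, map_zero, add_zero] at this
    exact this
  exact e.toLinearEquiv.map_eq_zero_iff.1 (Prod.ext h1 h2)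

theorem exists_linearEquiv_single_zero {F : Type} [Field F] {m : ℕ} (w : Fin (m + 1) → F)
    (hw : w ≠ 0) : ∃ L : (Fin (m + 1) → F) ≃ₗ[F] (Fin (m + 1) → F), L (Pi.single 0 1) = w := by
  obtain ⟨i, hi⟩ := Function.ne_iff.1 hw
  set f : (Fin (m + 1) → F) →ₗ[F] (Fin (m + 1) → F) :=
    LinearMap.funLeft F F (Equiv.swap 0 i) +
      (LinearMap.proj 0).smulRight (w - Pi.single i 1) with hf
  have hfz : ∀ z j, f z j = z (Equiv.swap 0 i j) +
      z 0 * (w j - Pi.single (M := fun _ => F) i 1 j) :=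
    fun z j => rfl
  have hfi : Function.Injective f := by
    rw [← LinearMap.ker_eq_bot, LinearMap.ker_eq_bot']
    intro z hz
    have h0 : z 0 = 0 := by
      have := hfz z i
      rw [hz] at this
      simp at this
      have h' : z 0 * w i = 0 := by linear_combination -this
      exact (mul_eq_zero.1 h').resolve_right hi
    ext j
    have := hfz z (Equiv.swap 0 i j)
    rw [hz, h0] at this
    simpa using this.symm
  refine ⟨LinearEquiv.ofInjectiveEndo f hfi, ?_⟩
  ext j
  rw [LinearEquiv.coe_ofInjectiveEndo, hfz]
  by_cases hj : j = i
  · subst hj; simp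
  · have : Equiv.swap 0 i j ≠ 0 := by
      intro h
      apply hj
      exact (Equiv.swap 0 i).injective (h.trans (Equiv.swap_apply_right 0 i).symm)
    simp [hj, this]

theorem qfPoly_eq_toBilin' {F : Type} [Field F] {n : ℕ} (ψ : QuadraticForm F (Fin n → F)) :
    qfPoly F ψ = Matrix.toBilin' ((coeffMat F ψ).map C) X X := by
  simp only [qfPoly, Matrix.toBilin'_apply, Matrix.map_apply]
  refine Finset.sum_congr rfl fun i _ => Finset.sum_congr rfl fun j _ => ?_
  ring

/-- Linear substitution of variables. -/
noncomputable def MvPolynomial.linearSubst {F : Type} [Field F] {n : ℕ}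
    (U : Matrix (Fin n) (Fin n) F) : MvPolynomial (Fin n) F →ₐ[F] MvPolynomial (Fin n) F :=
  aeval fun i => ∑ j, C (U i j) * X j

theorem MvPolynomial.linearSubst_linearSubst {F : Type} [Field F] {n : ℕ}
    {U U' : Matrix (Fin n) (Fin n) F} (hU : U * U' = 1) (f : MvPolynomial (Fin n) F) :
    linearSubst U' (linearSubst U f) = f := by
  have h : (linearSubst U').comp (linearSubst U) = AlgHom.id F _ := by
    refine algHom_ext fun i => ?_
    simp only [AlgHom.comp_apply, linearSubst, aeval_X, map_sum, map_mul, aeval_C,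
      algebraMap_eq, Finset.mul_sum]
    rw [Finset.sum_comm]
    simp only [← mul_assoc, ← map_mul, ← Finset.sum_mul, ← map_sum, ← Matrix.mul_apply, hU]
    simp [Matrix.one_apply]
  exact DFunLike.congr_fun h f

theorem MvPolynomial.linearSubst_toBilin' {F : Type} [Field F] {n : ℕ}
    (U M : Matrix (Fin n) (Fin n) F) :
    linearSubst U (Matrix.toBilin' (M.map C) X X) =
      Matrix.toBilin' ((U.transpose * M * U).map C) X X := by
  have h := toBilin'_map_of_comp (C : F →+* MvPolynomial (Fin n) F) C
    (linearSubst U).toRingHom (fun a => (linearSubst U).commutes a) M X X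
  refine h.symm.trans ?_
  have hX : (fun i => (linearSubst U).toRingHom (X i)) =
      Matrix.toLin' (U.map C) X := by
    ext1 i
    simp [linearSubst, Matrix.mulVec, dotProduct]
  rw [hX, Matrix.map_mul, Matrix.map_mul, Matrix.transpose_map, ← Matrix.toBilin'_comp]
  rfl

/-- The function field of a quadric maps to the quadratic extension of a rational function field
obtained by a linear change of coordinates. -/
theorem exists_ringHom_funField {F : Type} [Field F] {m : ℕ}
    (ψ : QuadraticForm F (Fin (m + 1) → F)) {U U' : Matrix (Fin (m + 1)) (Fin (m + 1)) F}
    (hU : U * U' = 1) (b : F) (hb : b ≠ 0) (p₀ : Polynomial (MvPolynomial (Fin m) F))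
    (hp₀ : p₀.Monic) (hψ : finSuccEquiv F m (linearSubst U (qfPoly F ψ)) =
      Polynomial.C (C b) * p₀) (p : Polynomial (RatField F m))
    (hp : p = p₀.map (algebraMap _ (RatField F m))) [Fact (Irreducible p)] :
    ∃ θ : FunField F ψ →+* AdjoinRoot p, ∀ a,
      θ (funFieldMap F ψ a) = AdjoinRoot.of p (ratInj F m a) := by
  set g : MvPolynomial (Fin (m + 1)) F →+* AdjoinRoot p :=
    ((AdjoinRoot.mk p).comp (peelVar F m)).comp
      (linearSubst U : MvPolynomial (Fin (m + 1)) F →+* _) with hg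
  have hgC : ∀ a, g (C a) = AdjoinRoot.of p (ratInj F m a) := by
    intro a
    have : linearSubst U (C a) = C a := (linearSubst U).commutes a
    simp [hg, this, peelVar_C]
  have hker : ∀ f, g f = 0 ↔ qfPoly F ψ ∣ f := by
    intro f
    have h1 : g f = AdjoinRoot.mk p
      ((finSuccEquiv F m (linearSubst U f)).map (algebraMap _ (RatField F m))) := rfl
    have hu : IsUnit (Polynomial.C (C b) : Polynomial (MvPolynomial (Fin m) F)) :=
      ((IsUnit.mk0 b hb).map C).map Polynomial.C
    rw [h1, AdjoinRoot.mk_eq_zero, hp, Polynomial.map_dvd_map _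
      (IsFractionRing.injective _ _) hp₀, ← hu.mul_left_dvd, ← hψ]
    constructor
    · intro h
      have h2 := map_dvd (linearSubst U') (map_dvd (finSuccEquiv F m).symm h)
      simpa [linearSubst_linearSubst hU] using h2
    · exact fun h => map_dvd _ (map_dvd _ h)
  have hle : ∀ f ∈ Ideal.span {qfPoly F ψ}, g f = 0 := fun f hf =>
    (hker f).2 (Ideal.mem_span_singleton.1 hf)
  set h : FunFieldRing F ψ →+* AdjoinRoot p := Ideal.Quotient.lift _ g hle with hh
  have hinj : Function.Injective h := by
    refine (injective_iff_map_eq_zero h).2 fun f hf => ?_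
    obtain ⟨f, rfl⟩ := Ideal.Quotient.mk_surjective f
    exact Ideal.Quotient.eq_zero_iff_mem.2 (Ideal.mem_span_singleton.2 ((hker f).1 hf))
  have : Nontrivial (FunFieldRing F ψ) := h.domain_nontrivial
  have hunit : ∀ y : nonZeroDivisors (FunFieldRing F ψ), IsUnit (h y) := fun y =>
    IsUnit.mk0 _ ((map_ne_zero_iff h hinj).2 (nonZeroDivisors.ne_zero y.2))
  set θ : FractionRing (FunFieldRing F ψ) →+* AdjoinRoot p := IsLocalization.lift hunit with hθ
  have hθ' : ∀ x, θ (algebraMap (FunFieldRing F ψ) _ x) = h x := IsLocalization.lift_eq hunit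
  exact ⟨θ, fun a => (hθ' (Ideal.Quotient.mk _ (C a))).trans (hgC a)⟩

theorem finSuccEquiv_toBilin' {F : Type} [Field F] {m : ℕ}
    (M : Matrix (Fin (m + 1)) (Fin (m + 1)) F) {b : F} (hb : b ≠ 0) (hM : M 0 0 = b) :
    finSuccEquiv F m (Matrix.toBilin' (M.map C) X X) = Polynomial.C (C b) *
      (Polynomial.X ^ 2 + Polynomial.C (∑ i, C (b⁻¹ * (M 0 i.succ + M i.succ 0)) * X i) *
        Polynomial.X + Polynomial.C
          (Matrix.toBilin' ((b⁻¹ • M.submatrix Fin.succ Fin.succ).map C) X X)) := by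
  have h := toBilin'_map_of_comp (C : F →+* MvPolynomial (Fin (m + 1)) F)
    ((Polynomial.C : _ →+* Polynomial (MvPolynomial (Fin m) F)).comp C)
    (finSuccEquiv F m : MvPolynomial (Fin (m + 1)) F →+* _)
    (fun a => by simp [finSuccEquiv_apply]) M X X
  have hX : (fun i => (finSuccEquiv F m : MvPolynomial (Fin (m + 1)) F →+* _) (X i)) =
      (Fin.cons Polynomial.X fun i => Polynomial.C (X i) :
        Fin (m + 1) → Polynomial (MvPolynomial (Fin m) F)) := by
    ext1 i
    refine Fin.cases ?_ (fun i => ?_) i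
    · simp [finSuccEquiv_X_zero]
    · simp [finSuccEquiv_X_succ]
  refine h.symm.trans ?_
  have hbb : (C b : MvPolynomial (Fin m) F) * C b⁻¹ = 1 := by
    rw [← map_mul, mul_inv_cancel₀ hb, map_one]
  rw [hX, toBilin'_cons]
  have h1 : Polynomial.C (C b) * Polynomial.C
        (∑ i, C (b⁻¹ * (M 0 i.succ + M i.succ 0)) * X i : MvPolynomial (Fin m) F) =
      ∑ i, (Polynomial.C (C (M 0 i.succ)) + Polynomial.C (C (M i.succ 0))) *
        Polynomial.C (X i) := by
    rw [← map_mul, Finset.mul_sum, map_sum]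
    refine Finset.sum_congr rfl fun i _ => ?_
    rw [map_mul C b⁻¹, ← mul_assoc, ← mul_assoc, hbb, one_mul, map_mul, map_add, map_add]
  have h2 : Polynomial.C (C b) * Polynomial.C
        (Matrix.toBilin' ((b⁻¹ • M.submatrix Fin.succ Fin.succ).map C) X X :
          MvPolynomial (Fin m) F) =
      Matrix.toBilin' ((M.map
        ((Polynomial.C : _ →+* Polynomial (MvPolynomial (Fin m) F)).comp C)).submatrix
        Fin.succ Fin.succ) (fun i => Polynomial.C (X i)) (fun i => Polynomial.C (X i)) := by
    rw [← map_mul]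
    simp only [Matrix.toBilin'_apply, Matrix.map_apply, Matrix.smul_apply, Matrix.submatrix_apply,
      Finset.mul_sum, map_sum, smul_eq_mul, map_mul, RingHom.comp_apply]
    refine Finset.sum_congr rfl fun i _ => Finset.sum_congr rfl fun j _ => ?_
    have hbb' : (Polynomial.C (C b) : Polynomial (MvPolynomial (Fin m) F)) *
        Polynomial.C (C b⁻¹) = 1 := by
      rw [← map_mul, hbb, map_one]
    linear_combination Polynomial.C (X i) * Polynomial.C (C (M i.succ j.succ)) *
      Polynomial.C (X j) * hbb'
  rw [← h2]
  simp only [Matrix.map_apply, RingHom.comp_apply, hM] at h1 ⊢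
  rw [← h1]
  ring

theorem exists_toBilin'_snoc {F : Type} [Field F] {m : ℕ} (G : Matrix (Fin m) (Fin m) F) :
    ∃ G' : Matrix (Fin (m + 1)) (Fin (m + 1)) F, ∀ (S : Type) [CommRing S] (e : F →+* S)
      (x : Fin m → S) (t : S), Matrix.toBilin' (G'.map e) (Fin.snoc x t : Fin (m + 1) → S)
        (Fin.snoc x t : Fin (m + 1) → S) = Matrix.toBilin' (G.map e) x x := by
  refine ⟨Matrix.of fun i j => Fin.lastCases (motive := fun _ => F) 0
    (fun i => Fin.lastCases (motive := fun _ => F) 0 (fun j => G i j) j) i, fun S _ e x t => ?_⟩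
  simp [Matrix.toBilin'_apply, Fin.sum_univ_castSucc]

theorem injective_of_regular {F V V' : Type} [Field F] [AddCommGroup V] [Module F V]
    [AddCommGroup V'] [Module F V'] (φ : QuadraticForm F V') (ψ : QuadraticForm F V)
    (hψ : ∀ x, ψ x = 0 → (∀ y, polar ψ x y = 0) → x = 0) {c : F} (hc : c ≠ 0) (f : V →ₗ[F] V')
    (h : ∀ x, φ (f x) = c * ψ x) : Function.Injective f := by
  rw [← LinearMap.ker_eq_bot, LinearMap.ker_eq_bot']
  intro x hx
  have h0 : ψ x = 0 := by
    have := h x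
    rw [hx, QuadraticMap.map_zero] at this
    exact (mul_eq_zero.1 this.symm).resolve_left hc
  refine hψ x h0 fun y => ?_
  have h1 := h (x + y)
  rw [map_add, hx, zero_add, h y] at h1
  have h2 := mul_left_cancel₀ hc h1
  simp [polar, ← h2, h0]

theorem stmt13 (F : Type) [Field F] [CharP F 2] (k n : ℕ) (hn : 2 ≤ n)
    (φ : QuadraticForm F (Fin k → F)) (hφa : φ.Anisotropic)
    (hφns : ∃ (r : ℕ) (a b : Fin r → F), φ.Equivalent (binsQF a b))
    (ψ : QuadraticForm F (Fin n → F))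
    (hψnd : ∃ (k' m : ℕ) (ψan : QuadraticForm F (Fin k' → F)),
      ψan.Anisotropic ∧ ψ.Equivalent (ψan.prod (hypQF F m)))
    (hψ01 : ¬ HasTypeRS ψ 0 1) (hψH : ¬ ψ.Equivalent (hypQF F 1))
    (hhyp : ∃ m : ℕ,
      (extendQF F (funFieldMap F ψ) φ).Equivalent (hypQF (FunField F ψ) m))
    (a b : F) (ha0 : a ≠ 0) (ha : ∃ v, φ v = a) (hb0 : b ≠ 0) (hb : ∃ w, ψ w = b) :
    Dominated ((a * b) • ψ) φ := by
  obtain ⟨m, rfl⟩ : ∃ m, n = m + 1 := ⟨n - 1, by lia⟩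
  obtain ⟨v, hv⟩ := ha
  obtain ⟨w, hw⟩ := hb
  obtain ⟨r, hr⟩ := hhyp
  have hreg : ∀ x, ψ x = 0 → (∀ y, polar ψ x y = 0) → x = 0 := by
    obtain ⟨k', m', ψan, h1, h2⟩ := hψnd
    exact eq_zero_of_equivalent_anisotropic_prod_hypQF ψ ψan h1 h2
  have hA : ∀ x, Matrix.toBilin' (coeffMat F φ) x x = 0 → x = 0 := fun x hx =>
    hφa x (by rwa [toBilin'_coeffMat] at hx)
  -- coordinates in which the first basis vector represents `b`
  obtain ⟨L, hL⟩ := exists_linearEquiv_single_zero w (by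
    rintro rfl
    exact hb0 (hw.symm.trans (QuadraticMap.map_zero ψ)))
  set U := LinearMap.toMatrix' L.toLinearMap with hU
  set U' := LinearMap.toMatrix' L.symm.toLinearMap with hU'
  have hUU : U * U' = 1 := by
    rw [hU, hU', ← LinearMap.toMatrix'_comp, LinearEquiv.comp_symm, LinearMap.toMatrix'_id]
  set M := U.transpose * coeffMat F ψ * U with hM
  have hMψ : ∀ z, Matrix.toBilin' M z z = ψ (L z) := by
    intro z
    rw [hM, ← Matrix.toBilin'_comp, ← toBilin'_coeffMat ψ, hU, Matrix.toLin'_toMatrix']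
    rfl
  have hM0 : M 0 0 = b := by
    rw [← hw, ← hL, ← hMψ, Matrix.toBilin'_single]
  set β : Fin m → F := fun i => b⁻¹ * (M 0 i.succ + M i.succ 0) with hβ
  set G := b⁻¹ • M.submatrix Fin.succ Fin.succ with hG
  have hcons : ∀ t x, ψ (L (Fin.cons t x)) =
      b * (t ^ 2 + t * ∑ i, β i * x i + Matrix.toBilin' G x x) := by
    intro t x
    have h1 : b * ∑ i, β i * x i = ∑ i, (M 0 i.succ + M i.succ 0) * x i := by
      rw [Finset.mul_sum]
      refine Finset.sum_congr rfl fun i _ => ?_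
      rw [hβ, ← mul_assoc, mul_inv_cancel_left₀ hb0]
    have h2 : b * Matrix.toBilin' G x x =
        Matrix.toBilin' (M.submatrix Fin.succ Fin.succ) x x := by
      rw [hG, map_smul, LinearMap.smul_apply, LinearMap.smul_apply, smul_eq_mul,
        mul_inv_cancel_left₀ hb0]
    rw [← hMψ, toBilin'_cons, hM0]
    linear_combination -t * h1 - h2
  set β₀ : MvPolynomial (Fin m) F := ∑ i, C (β i) * X i with hβ₀
  set γ₀ : MvPolynomial (Fin m) F := Matrix.toBilin' (G.map C) X X with hγ₀
  have hirr := irreducible_quadratic_ratField β₀ γ₀ (by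
    intro ρ hρ
    obtain ⟨c, hc⟩ := exists_linear_root β G ρ hρ
    refine hψH (equivalent_hypQF_one_of_eq_mul ψ (by simpa using hn) hreg
      (b • (LinearMap.proj 0 - ∑ i, c i • LinearMap.proj i.succ) ∘ₗ L.symm.toLinearMap)
      ((LinearMap.proj 0 + ∑ i, (β i + c i) • LinearMap.proj i.succ) ∘ₗ L.symm.toLinearMap)
      fun x => ?_)
    obtain ⟨z, rfl⟩ := L.surjective x
    rw [← Fin.cons_self_tail z, hcons]
    have hz := hc (Fin.tail z)
    simp only [Fin.tail] at hz ⊢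
    simp [add_mul, Finset.sum_add_distrib]
    linear_combination b * hz)
  obtain ⟨p, hp⟩ : ∃ p, p = (Polynomial.X ^ 2 + Polynomial.C β₀ * Polynomial.X +
    Polynomial.C γ₀).map (algebraMap _ (RatField F m)) := ⟨_, rfl⟩
  rw [← hp] at hirr
  have : Fact (Irreducible p) := ⟨hirr⟩
  obtain ⟨θ, hθ⟩ := exists_ringHom_funField ψ hUU b hb0 _ (by monicity!)
    (by rw [qfPoly_eq_toBilin', linearSubst_toBilin', finSuccEquiv_toBilin' _ hb0 hM0]) p hp
  obtain ⟨hk, W, hW, hW0⟩ := exists_isotropic_of_hyperbolic (funFieldMap F ψ) θ φ hr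
  have hAr := ratField_anisotropic (coeffMat F φ) hA m
  obtain ⟨y, hy, hyv⟩ := exists_similarity_vector ((coeffMat F φ).map (ratInj F m)) hAr
    (algebraMap _ _ β₀) (algebraMap _ _ γ₀) hk p (by rw [hp]; simp) W hW (by
      intro s
      have hcomp : θ.comp (funFieldMap F ψ) = (AdjoinRoot.of p).comp (ratInj F m) :=
        RingHom.ext hθ
      rw [Matrix.map_map, ← RingHom.coe_comp, ← hcomp]
      exact hW0 s) (fun i => ratInj F m (v i))
  rw [toBilin'_map, toBilin'_coeffMat, hv] at hy hyv
  obtain ⟨G', hG'⟩ := exists_toBilin'_snoc (a • G)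
  obtain ⟨f, hf⟩ := ratField_descent (coeffMat F φ) hA m Unit (fun _ => v) G'
    (fun _ => (Fin.snoc (a • β) 0 : Fin (m + 1) → F)) y (by
      rw [hy, genericVec, hG', mul_comm, ratInj, RingHom.comp_apply, ← map_mul, hγ₀]
      congr 1
      simp only [Matrix.toBilin'_apply, Finset.mul_sum, Matrix.map_apply, Matrix.smul_apply,
        smul_eq_mul, map_mul]
      refine Finset.sum_congr rfl fun i _ => Finset.sum_congr rfl fun j _ => ?_
      ring) (by
      intro _
      rw [add_comm, hyv, mul_comm, ratInj, RingHom.comp_apply, ← map_mul, hβ₀]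
      congr 1
      simp [Fin.sum_univ_castSucc, genericVec, Finset.mul_sum, mul_assoc])
  set ι : (Fin (m + 1) → F) →ₗ[F] (Fin (m + 1) → F) :=
    LinearMap.pi (Fin.lastCases 0 fun i => LinearMap.proj i.succ) with hι
  have hιc : ∀ t x, ι (Fin.cons t x) = (Fin.snoc x 0 : Fin (m + 1) → F) := by
    intro t x
    ext i
    refine Fin.lastCases ?_ (fun i => ?_) i <;> simp [hι]
  set D := (b • ((LinearMap.proj 0).smulRight v + f ∘ₗ ι)) ∘ₗ L.symm.toLinearMap with hD
  have hDφ : ∀ x, φ (D x) = a * b * ψ x := by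
    intro x
    obtain ⟨z, rfl⟩ := L.surjective x
    rw [← Fin.cons_self_tail z, hcons]
    set t := z 0
    set x := Fin.tail z
    have h1 : D (L (Fin.cons t x)) = b • (t • v + f (Fin.snoc x 0)) := by
      simp [hD, hιc]
    obtain ⟨h2, h3⟩ := hf (Fin.snoc x 0)
    have h4 := hG' F (RingHom.id F) x 0
    have h5 := h3 ()
    simp [Fin.sum_univ_castSucc, mul_assoc, ← Finset.mul_sum] at h4 h5
    rw [h1, ← toBilin'_coeffMat]
    have h6 := toBilin'_coeffMat φ v
    rw [hv] at h6
    simp only [map_add, map_smul, LinearMap.add_apply, LinearMap.smul_apply, smul_eq_mul]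
    linear_combination b ^ 2 * (t ^ 2 * h6 + t * h5 + h2 + h4)
  exact ⟨D, injective_of_regular φ ψ hreg (mul_ne_zero ha0 hb0) D hDφ, fun x => (hDφ x).symm⟩
end
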